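/- For every n ∈ ℕ there exists a function ε : [1,∞) → (0,∞) with ε(t) → 0 as t → ∞ such that the set {(ζ(s_t), ζ^(1)(s_t), …, ζ^(n)(s_t)) : t ∈ [1,∞)}, where s_t := 1/2 + ε(t) + i·t and ζ^(i) denotes the i-th derivative of ζ, is dense in ℂ^(n+1). -/

import Mathlib

open Complex Filter Set Topology MeasureTheory


lemma gauss_planch (φ : ℝ → ℂ) (h1 : Integrable φ) (h2 : Integrable (fun u => ‖φ u‖ ^ 2))
    {b : ℝ} (hb : 0 < b) :
    Integrable (fun t : ℝ => ‖∫ u : ℝ, φ u * cexp (I * t * u)‖ ^ 2 * Real.exp (-b * t ^ 2)) ∧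
    ∫ t : ℝ, ‖∫ u : ℝ, φ u * cexp (I * t * u)‖ ^ 2 * Real.exp (-b * t ^ 2)
      ≤ 2 * Real.pi * ∫ u, ‖φ u‖ ^ 2 := by
  set K : ℝ → ℝ := fun w => ‖((Real.pi : ℂ) / (b : ℂ)) ^ (1 / 2 : ℂ)‖ * Real.exp (-(1 / (4 * b)) * w ^ 2) with hK
  have hKint : Integrable K := (integrable_exp_neg_mul_sq (by positivity)).const_mul _
  have hKval : ∫ w, K w = 2 * Real.pi := by
    simp only [hK]
    rw [integral_const_mul, integral_gaussian]
    have : ((Real.pi : ℂ) / (b : ℂ)) = ((Real.pi / b : ℝ) : ℂ) := by push_cast; rfl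
    rw [this, Complex.norm_cpow_eq_rpow_re_of_pos (by positivity)]
    have e : (1 / 2 : ℂ).re = 1 / 2 := by norm_num
    rw [e, ← Real.sqrt_eq_rpow, ← Real.sqrt_mul (by positivity)]
    have : Real.pi / b * (Real.pi / (1 / (4 * b))) = (2 * Real.pi) ^ 2 := by
      field_simp; ring
    rw [this, Real.sqrt_sq (by positivity)]
  have hKsymm : ∀ w, K (-w) = K w := by intro w; simp [hK]
  -- big integrand
  set F : ℝ → ℝ × ℝ → ℂ := fun t p => cexp (-(b:ℂ) * (t:ℂ) ^ 2) * (φ p.1 * (starRingEnd ℂ) (φ p.2))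
      * cexp (I * ((p.1 - p.2 : ℝ) : ℂ) * t) with hF
  have hg : Integrable (fun t : ℝ => cexp (-(b:ℂ) * (t:ℂ) ^ 2)) := by
    exact integrable_cexp_neg_mul_sq (by simpa using hb)
  have h1c : Integrable (fun u => (starRingEnd ℂ) (φ u)) := by
    exact (Complex.conjCLE : ℂ →L[ℝ] ℂ).integrable_comp h1
  have hprod : Integrable (fun p : ℝ × ℝ => φ p.1 * (starRingEnd ℂ) (φ p.2)) (volume.prod volume) :=
    h1.mul_prod h1c
  have hFint : Integrable (Function.uncurry F) (volume.prod (volume.prod volume)) := by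
    have := hg.mul_prod hprod
    refine Integrable.mono this ?_ ?_
    · refine AEStronglyMeasurable.mul this.1 ?_
      apply Continuous.aestronglyMeasurable
      fun_prop
    · refine Eventually.of_forall fun p => ?_
      simp only [Function.uncurry, hF]
      rw [norm_mul _ (cexp (I * _ * _))]
      have : ‖cexp (I * ((p.2.1 - p.2.2 : ℝ) : ℂ) * p.1)‖ = 1 := by
        rw [mul_assoc, mul_comm, ← Complex.ofReal_mul, Complex.norm_exp_ofReal_mul_I]
      rw [this, mul_one]
  have hin : ∀ t : ℝ, ∫ p, F t p ∂(volume.prod volume)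
      = ((‖∫ u : ℝ, φ u * cexp (I * t * u)‖ ^ 2 * Real.exp (-b * t ^ 2) : ℝ) : ℂ) := by
    intro t
    have e : ∀ p : ℝ × ℝ, F t p = cexp (-(b:ℂ) * (t:ℂ) ^ 2) *
        ((φ p.1 * cexp (I * t * p.1)) * (starRingEnd ℂ) (φ p.2 * cexp (I * t * p.2))) := by
      intro p
      simp only [hF, map_mul, ← Complex.exp_conj, Complex.conj_I, Complex.conj_ofReal]
      have : cexp (I * ((p.1 - p.2 : ℝ) : ℂ) * t) = cexp (I * t * p.1) * cexp (-I * t * p.2) := by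
        rw [← Complex.exp_add]; congr 1; push_cast; ring
      rw [this]; ring
    simp_rw [e]
    rw [integral_const_mul, integral_prod_mul (fun u : ℝ => φ u * cexp (I * t * u))
      (fun u : ℝ => (starRingEnd ℂ) (φ u * cexp (I * t * u))), integral_conj, Complex.mul_conj,
      Complex.normSq_eq_norm_sq]
    push_cast
    ring
  have hswap := integral_integral_swap hFint
  have hleft : Integrable (fun t : ℝ => ∫ p, F t p ∂(volume.prod volume)) := hFint.integral_prod_left
  simp_rw [hin] at hswap hleft
  refine ⟨by simpa only [RCLike.re_to_complex, Complex.ofReal_re] using hleft.re, ?_⟩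
  rw [integral_complex_ofReal] at hswap
  have hker : ∀ p : ℝ × ℝ, ‖∫ t : ℝ, F t p‖ = ‖φ p.1‖ * ‖φ p.2‖ * K (p.1 - p.2) := by
    intro p
    have e : ∀ t : ℝ, F t p = (φ p.1 * (starRingEnd ℂ) (φ p.2)) *
       (cexp (I * ((p.1 - p.2 : ℝ) : ℂ) * t) * cexp (-(b:ℂ) * (t:ℂ) ^ 2)) := by
      intro t; simp only [hF]; ring
    simp_rw [e]
    rw [integral_const_mul, fourierIntegral_gaussian (by simpa using hb), norm_mul, norm_mul, norm_mul,
      RCLike.norm_conj]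
    congr 1
    simp only [hK]
    congr 1
    rw [Complex.norm_exp]
    congr 1
    have : -((p.1 - p.2 : ℝ) : ℂ) ^ 2 / (4 * (b:ℂ)) = ((-(1 / (4 * b)) * (p.1 - p.2) ^ 2 : ℝ) : ℂ) := by
      push_cast; ring
    rw [this, Complex.ofReal_re]
  have hconv : Integrable (fun p : ℝ × ℝ => ‖φ p.2‖ ^ 2 * K (p.1 - p.2)) (volume.prod volume) := by
    exact h2.convolution_integrand (ContinuousLinearMap.mul ℝ ℝ) hKint
  have hconv' : Integrable (fun p : ℝ × ℝ => ‖φ p.1‖ ^ 2 * K (p.1 - p.2)) (volume.prod volume) := by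
    have := hconv.swap
    refine this.congr (Eventually.of_forall fun p => ?_)
    simp only [Function.comp, Prod.swap]
    rw [← hKsymm, neg_sub]
  have hval : ∫ p : ℝ × ℝ, ‖φ p.2‖ ^ 2 * K (p.1 - p.2) ∂(volume.prod volume) = 2 * Real.pi * ∫ u, ‖φ u‖ ^ 2 := by
    rw [integral_prod_symm _ hconv]
    simp only
    have : ∀ y : ℝ, ∫ x : ℝ, ‖φ y‖ ^ 2 * K (x - y) = ‖φ y‖ ^ 2 * (2 * Real.pi) := by
      intro y; rw [integral_const_mul, integral_sub_right_eq_self, hKval]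
    simp_rw [this]
    rw [integral_mul_const, mul_comm]
  have hval' : ∫ p : ℝ × ℝ, ‖φ p.1‖ ^ 2 * K (p.1 - p.2) ∂(volume.prod volume) = 2 * Real.pi * ∫ u, ‖φ u‖ ^ 2 := by
    rw [integral_prod _ hconv']
    simp only
    have : ∀ x : ℝ, ∫ y : ℝ, ‖φ x‖ ^ 2 * K (x - y) = ‖φ x‖ ^ 2 * (2 * Real.pi) := by
      intro y; rw [integral_const_mul, integral_sub_left_eq_self, hKval]
    simp_rw [this]
    rw [integral_mul_const, mul_comm]
  have hKnn : ∀ w, 0 ≤ K w := fun w => by simp only [hK]; positivity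
  set A := ∫ t : ℝ, ‖∫ u : ℝ, φ u * cexp (I * t * u)‖ ^ 2 * Real.exp (-b * t ^ 2)
  calc A ≤ ‖(A : ℂ)‖ := by rw [Complex.norm_real]; exact le_abs_self A
    _ = ‖∫ p, ∫ t, F t p ∂volume ∂(volume.prod volume)‖ := by
        congr 1
    _ ≤ ∫ p : ℝ × ℝ, (1 / 2) * (‖φ p.1‖ ^ 2 * K (p.1 - p.2) + ‖φ p.2‖ ^ 2 * K (p.1 - p.2)) ∂(volume.prod volume) := by
        refine norm_integral_le_of_norm_le ((hconv'.add hconv).const_mul _) (Eventually.of_forall fun p => ?_)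
        rw [hker]
        have := hKnn (p.1 - p.2)
        nlinarith [mul_nonneg this (sq_nonneg (‖φ p.1‖ - ‖φ p.2‖))]
    _ = 2 * Real.pi * ∫ u, ‖φ u‖ ^ 2 := by
        rw [integral_const_mul, integral_add hconv' hconv, hval, hval']; ring


lemma HasMellin.congr_ae' {f g : ℝ → ℂ} {s m : ℂ} (h : HasMellin f s m)
    (hfg : ∀ᵐ x ∂(volume : Measure ℝ), 0 < x → f x = g x) : HasMellin g s m := by
  have key : (fun t : ℝ => (t : ℂ) ^ (s - 1) • f t) =ᵐ[volume.restrict (Ioi 0)]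
      (fun t : ℝ => (t : ℂ) ^ (s - 1) • g t) := by
    rw [Filter.EventuallyEq, ae_restrict_iff' measurableSet_Ioi]
    filter_upwards [hfg] with x hx h0
    rw [hx h0]
  refine ⟨h.1.congr key, ?_⟩
  rw [← h.2, mellin, mellin]
  exact integral_congr_ae key.symm

noncomputable def zf1 : ℝ → ℂ := (Ioi (1:ℝ)).indicator (fun x => ((⌊x⌋₊ : ℂ) - x))

lemma zf1_meas : Measurable zf1 := by
  unfold zf1
  refine Measurable.indicator ?_ measurableSet_Ioi
  have : Measurable (fun x : ℝ => (⌊x⌋₊ : ℂ)) :=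
    (measurable_from_nat (f := fun n : ℕ => (n : ℂ))).comp Nat.measurable_floor
  exact this.sub Complex.measurable_ofReal

lemma zf1_bound (x : ℝ) : ‖zf1 x‖ ≤ 1 := by
  unfold zf1
  by_cases hx : x ∈ Ioi (1:ℝ)
  · rw [indicator_of_mem hx]
    have h0 : (0:ℝ) ≤ x := le_trans zero_le_one (le_of_lt hx)
    have : ((⌊x⌋₊ : ℂ) - x) = ((⌊x⌋₊ - x : ℝ) : ℂ) := by push_cast; rfl
    rw [this, Complex.norm_real, Real.norm_eq_abs, abs_le]
    constructor
    · linarith [Nat.lt_floor_add_one x]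
    · linarith [Nat.floor_le h0]
  · rw [indicator_of_notMem hx]; simp

lemma zf1_locInt : LocallyIntegrableOn zf1 (Ioi 0) := by
  apply LocallyIntegrable.locallyIntegrableOn
  have h1 : LocallyIntegrable (fun _ : ℝ => (1:ℝ)) := locallyIntegrable_const 1
  refine h1.mono zf1_meas.aestronglyMeasurable (Eventually.of_forall fun x => ?_)
  simpa using zf1_bound x

lemma zf1_O_top : zf1 =O[atTop] fun x : ℝ => x ^ (-(0:ℝ)) := by
  simp only [neg_zero, Real.rpow_zero]
  exact Asymptotics.IsBigO.of_bound 1 (Eventually.of_forall fun x => by simpa using zf1_bound x)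

lemma zf1_O_zero (b : ℝ) : zf1 =O[𝓝[>] 0] fun x : ℝ => x ^ (-b) := by
  have : zf1 =ᶠ[𝓝[>] 0] fun _ => 0 := by
    have : Iio (1:ℝ) ∈ 𝓝[>] (0:ℝ) := mem_nhdsWithin_of_mem_nhds (Iio_mem_nhds one_pos)
    filter_upwards [this] with x hx
    unfold zf1
    rw [indicator_of_notMem]
    simp only [mem_Ioi, not_lt]; exact le_of_lt hx
  exact this.trans_isBigO (Asymptotics.isBigO_zero _ _)

lemma zf1_diff {s : ℂ} (hs : 0 < s.re) : DifferentiableAt ℂ (mellin zf1) (-s) :=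
  mellin_differentiableAt_of_isBigO_rpow zf1_locInt zf1_O_top (by simpa using hs)
    (zf1_O_zero ((-s).re - 1)) (by linarith)

lemma zf1_conv {s : ℂ} (hs : 0 < s.re) : MellinConvergent zf1 (-s) :=
  mellinConvergent_of_isBigO_rpow zf1_locInt zf1_O_top (by simpa using hs)
    (zf1_O_zero ((-s).re - 1)) (by linarith)

lemma zf1_mellin_eq (s : ℂ) : mellin zf1 (-s) = ∫ t in Ioi (1:ℝ), ((⌊t⌋₊ : ℂ) - t) * (t:ℂ) ^ (-(s+1)) := by
  have : ∀ t : ℝ, (t : ℂ) ^ (-s - 1) • zf1 t = (Ioi (1:ℝ)).indicator (fun t : ℝ => ((⌊t⌋₊ : ℂ) - t) * (t:ℂ) ^ (-(s+1))) t := by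
    intro t
    unfold zf1
    by_cases ht : t ∈ Ioi (1:ℝ)
    · rw [indicator_of_mem ht, indicator_of_mem ht, smul_eq_mul, mul_comm]; congr 2; ring
    · rw [indicator_of_notMem ht, indicator_of_notMem ht]; simp
  rw [mellin]
  simp_rw [this]
  rw [setIntegral_indicator measurableSet_Ioi]
  congr 2
  ext x; simp only [mem_inter_iff, mem_Ioi]
  constructor
  · exact fun h => h.2
  · exact fun h => ⟨by linarith, h⟩

lemma zeta_of_one_lt {s : ℂ} (hs : 1 < s.re) : riemannZeta s = s / (s - 1) + s * mellin zf1 (-s) := by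
  have h0 : (s - 1) ≠ 0 := by
    intro h; rw [sub_eq_zero] at h; rw [h] at hs; simp at hs
  have h := LSeries_eq_mul_integral_of_nonneg (fun _ => (1:ℝ)) (r := 1) zero_le_one (s := s) hs
    (by simpa using Asymptotics.isBigO_refl _ _) (fun _ => zero_le_one)
  have e1 : LSeries (fun _ => (((1:ℝ)) : ℂ)) s = riemannZeta s := by
    rw [← LSeries_one_eq_riemannZeta hs]; congr 1
  rw [e1] at h
  have hcv : IntegrableOn (fun t : ℝ => ((⌊t⌋₊ : ℂ) - t) * (t:ℂ) ^ (-(s+1))) (Ioi 1) := by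
    have h2 := (zf1_conv (s := s) (by linarith)).mono_set (Ioi_subset_Ioi (zero_le_one))
    refine h2.congr_fun (fun t ht => ?_) measurableSet_Ioi
    simp only [zf1]
    rw [indicator_of_mem ht, smul_eq_mul, mul_comm]; congr 2; ring
  have hcv2 : IntegrableOn (fun t : ℝ => (t:ℂ) ^ (-s)) (Ioi 1) :=
    integrableOn_Ioi_cpow_of_lt (by simpa using hs) one_pos
  have hs2 : ∫ t in Ioi (1:ℝ), (t:ℂ) ^ (-s) = 1 / (s - 1) := by
    rw [integral_Ioi_cpow_of_lt (by simpa using hs) one_pos]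
    simp only [ofReal_one, one_cpow]
    rw [(by ring : -s + 1 = -(s - 1)), neg_div_neg_eq]
  have : ∫ (t : ℝ) in Ioi 1, (∑ k ∈ Finset.Icc 1 ⌊t⌋₊, (((1:ℝ)) : ℂ)) * (t:ℂ) ^ (-(s + 1))
      = mellin zf1 (-s) + 1 / (s - 1) := by
    rw [zf1_mellin_eq, ← hs2, ← integral_add hcv hcv2]
    refine setIntegral_congr_fun measurableSet_Ioi fun t ht => ?_
    have ht0 : (t : ℂ) ≠ 0 := by
      rw [Ne, ofReal_eq_zero]; exact ne_of_gt (lt_trans zero_lt_one ht)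
    have : (t:ℂ) ^ (-s) = t * (t:ℂ) ^ (-(s+1)) := by
      have h9 : -s = 1 + -(s + 1) := by ring
      rw [h9, Complex.cpow_add _ _ ht0, cpow_one]
    simp only [this]
    simp
    ring
  rw [this] at h
  rw [h]; field_simp; ring

lemma zeta_of_pos {s : ℂ} (hs : 0 < s.re) (hs1 : s ≠ 1) :
    riemannZeta s = s / (s - 1) + s * mellin zf1 (-s) := by
  have hU : IsOpen {s : ℂ | 0 < s.re} := isOpen_lt continuous_const continuous_re
  have hA : AnalyticOnNhd ℂ riemannZeta₁ {s : ℂ | 0 < s.re} :=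
    fun z _ => differentiable_riemannZeta₁.analyticAt z
  have hB : AnalyticOnNhd ℂ (fun s => s + s * (s - 1) * mellin zf1 (-s)) {s : ℂ | 0 < s.re} := by
    apply DifferentiableOn.analyticOnNhd _ hU
    intro z hz
    have h1 : DifferentiableAt ℂ (fun s => mellin zf1 (-s)) z :=
      DifferentiableAt.fun_comp' (g := mellin zf1) z (zf1_diff hz) differentiable_neg.differentiableAt
    exact (differentiableAt_id.add ((differentiableAt_id.mul (differentiableAt_id.sub_const 1)).mul h1)).differentiableWithinAt
  have hpre : IsPreconnected {s : ℂ | 0 < s.re} := (convex_halfSpace_re_gt 0).isPreconnected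
  have heq := hA.eqOn_of_preconnected_of_eventuallyEq hB hpre (z₀ := 2) (by simp) (by
    have : {s : ℂ | 1 < s.re} ∈ 𝓝 (2:ℂ) := (isOpen_lt continuous_const continuous_re).mem_nhds (by simp)
    filter_upwards [this] with z hz
    have hz1 : z - 1 ≠ 0 := by
      intro h; rw [sub_eq_zero] at h; rw [h] at hz; simp at hz
    have h1 := riemannZeta_eq_inv_sub_mul (sub_ne_zero.mp hz1)
    rw [zeta_of_one_lt hz] at h1
    field_simp at h1
    rw [← h1]; ring)
  have h2 := heq hs
  rw [riemannZeta_eq_inv_sub_mul hs1, h2]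
  have : s - 1 ≠ 0 := sub_ne_zero.mpr hs1
  simp only
  field_simp

noncomputable def GN (N : ℕ) (x : ℝ) : ℝ := ((⌊x⌋₊ - N : ℕ) : ℝ) - x

lemma hasMellin_Ici {a : ℝ} (ha : 0 < a) {s : ℂ} (hs : 0 < s.re) :
    HasMellin ((Ici a).indicator (fun _ => (1:ℂ))) (-s) ((a:ℂ) ^ (-s) / s) := by
  have e : (fun t : ℝ => (t:ℂ) ^ (-s - 1) • (Ici a).indicator (fun _ => (1:ℂ)) t)
     = (Ici a).indicator (fun t : ℝ => (t:ℂ) ^ (-s - 1)) := by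
    ext t
    by_cases ht : t ∈ Ici a
    · rw [indicator_of_mem ht, indicator_of_mem ht]; simp
    · rw [indicator_of_notMem ht, indicator_of_notMem ht]; simp
  have hr : (-s - 1).re < -1 := by simp; linarith
  have hsub : Ioi (0:ℝ) ∩ Ici a = Ici a := by
    ext x; simp only [mem_inter_iff, mem_Ioi, mem_Ici]
    exact ⟨fun h => h.2, fun h => ⟨by linarith, h⟩⟩
  constructor
  · rw [MellinConvergent, e, IntegrableOn, integrable_indicator_iff measurableSet_Ici, IntegrableOn,
      Measure.restrict_restrict measurableSet_Ici, inter_comm, hsub]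
    exact (integrableOn_Ici_iff_integrableOn_Ioi).mpr (integrableOn_Ioi_cpow_of_lt hr ha)
  · rw [mellin, e, setIntegral_indicator measurableSet_Ici, hsub, integral_Ici_eq_integral_Ioi,
      integral_Ioi_cpow_of_lt hr ha]
    simp only [sub_add_cancel]
    rw [neg_div_neg_eq]

lemma hasMellin_min (N : ℕ) {s : ℂ} (hs : 0 < s.re) :
    HasMellin (fun x : ℝ => ((min ⌊x⌋₊ N : ℕ) : ℂ)) (-s) ((∑ n ∈ Finset.Icc 1 N, (n:ℂ) ^ (-s)) / s) := by
  induction N with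
  | zero => simp [HasMellin, MellinConvergent, mellin]
  | succ N ih =>
    have h2 := hasMellin_Ici (a := (N + 1 : ℝ)) (by positivity) hs
    have h3 := hasMellin_add ih.1 h2.1
    rw [ih.2, h2.2] at h3
    rw [Finset.sum_Icc_succ_top (by omega), add_div]
    have h5 : ((N + 1 : ℕ) : ℂ) = (((N : ℝ) + 1 : ℝ) : ℂ) := by push_cast; rfl
    rw [h5]
    refine h3.congr_ae' (Eventually.of_forall fun x hx => ?_)
    by_cases hN : (N + 1 : ℝ) ≤ x
    · have h4 : N + 1 ≤ ⌊x⌋₊ := Nat.le_floor (by push_cast; exact hN)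
      have hm : x ∈ Ici (N + 1 : ℝ) := hN
      rw [indicator_of_mem hm]
      rw [min_eq_right (by omega : N ≤ ⌊x⌋₊), min_eq_right h4]; push_cast; rfl
    · have h4 : ⌊x⌋₊ < N + 1 := by
        rw [Nat.floor_lt hx.le]; push_cast; exact not_le.mp hN
      have hm : x ∉ Ici (N + 1 : ℝ) := hN
      rw [indicator_of_notMem hm]
      rw [min_eq_left (by omega : ⌊x⌋₊ ≤ N), min_eq_left (by omega)]; simp

theorem hasMellin_GN (N : ℕ) {s : ℂ} (hs : 0 < s.re) (hs1 : s.re < 1) :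
    HasMellin (fun x : ℝ => (GN N x : ℂ)) (-s)
      ((riemannZeta s - ∑ n ∈ Finset.Icc 1 N, (n:ℂ) ^ (-s)) / s) := by
  have hne : s ≠ 1 := by rintro rfl; simp at hs1
  have hne0 : s ≠ 0 := by rintro rfl; simp at hs
  have h1 : HasMellin zf1 (-s) (mellin zf1 (-s)) := ⟨zf1_conv hs, rfl⟩
  have h2 := hasMellin_cpow_Ioc (1:ℂ) (s := -s) (by simp; linarith)
  have h3 := hasMellin_min N hs
  have h4 := hasMellin_sub h1.1 h2.1
  have h5 := hasMellin_sub h4.1 h3.1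
  rw [h4.2, h3.2, h2.2] at h5
  have e : (riemannZeta s - ∑ n ∈ Finset.Icc 1 N, (n:ℂ) ^ (-s)) / s =
     mellin zf1 (-s) - 1 / (-s + 1) - (∑ n ∈ Finset.Icc 1 N, (n:ℂ) ^ (-s)) / s := by
    rw [zeta_of_pos hs hne]
    have a1 : s - 1 ≠ 0 := sub_ne_zero.mpr hne
    have a3 : -s + 1 = -(s - 1) := by ring
    rw [a3]
    field_simp
    ring
  rw [e]
  refine h5.congr_ae' ?_
  have : ∀ᵐ x : ℝ, x ≠ 1 := by simp [ae_iff]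
  filter_upwards [this] with x hx hx0
  have hsub : ((⌊x⌋₊ - N : ℕ) : ℂ) = (⌊x⌋₊ : ℂ) - ((min ⌊x⌋₊ N : ℕ) : ℂ) := by
    rw [eq_sub_iff_add_eq]; norm_cast; omega
  rw [GN, ofReal_sub, ofReal_natCast, hsub]
  unfold zf1
  rcases lt_or_gt_of_ne hx with h | h
  · rw [indicator_of_notMem (by simp; linarith), indicator_of_mem (by simp; constructor <;> linarith)]
    rw [Nat.floor_eq_zero.mpr h]; simp
  · rw [indicator_of_mem (by simpa using h), indicator_of_notMem (by simp; intro; linarith)]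
    ring

lemma GN_meas (N : ℕ) : Measurable (GN N) := by
  unfold GN
  have : Measurable (fun x : ℝ => ((⌊x⌋₊ - N : ℕ) : ℝ)) :=
    (measurable_from_nat (f := fun n : ℕ => ((n - N : ℕ) : ℝ))).comp Nat.measurable_floor
  exact this.sub measurable_id

lemma GN_abs_le (N : ℕ) {x : ℝ} (hx : 0 ≤ x) : |GN N x| ≤ x ∧ |GN N x| ≤ N + 1 := by
  unfold GN
  have h1 : ((⌊x⌋₊ - N : ℕ) : ℝ) ≤ ⌊x⌋₊ := by exact_mod_cast Nat.sub_le _ _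
  have h2 : (⌊x⌋₊ : ℝ) ≤ ((⌊x⌋₊ - N : ℕ) : ℝ) + N := by exact_mod_cast (by omega : ⌊x⌋₊ ≤ ⌊x⌋₊ - N + N)
  have h3 := Nat.floor_le hx
  have h4 := Nat.lt_floor_add_one x
  have h5 : (0:ℝ) ≤ ((⌊x⌋₊ - N : ℕ) : ℝ) := Nat.cast_nonneg _
  have h6 : (0:ℝ) ≤ N := Nat.cast_nonneg _
  constructor <;> rw [abs_le] <;> constructor <;> linarith

noncomputable def phiG (σ : ℝ) (N : ℕ) (u : ℝ) : ℝ := Real.exp (σ * u) * GN N (Real.exp (-u))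

lemma phiG_meas (σ : ℝ) (N : ℕ) : Measurable (phiG σ N) := by
  unfold phiG
  have := (GN_meas N).comp (Real.measurable_exp.comp measurable_neg)
  exact (by fun_prop : Measurable fun u : ℝ => Real.exp (σ * u)).mul this

lemma phiG_bound {σ : ℝ} (h0 : 0 < σ) (h1 : σ < 1) (N : ℕ) (u : ℝ) :
    |phiG σ N u| ≤ N + 1 ∧
    |phiG σ N u| ≤ (Iic (0:ℝ)).indicator (fun u => (N + 1) * Real.exp (σ * u)) u
      + (Ioi (0:ℝ)).indicator (fun u => Real.exp ((σ - 1) * u)) u := by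
  unfold phiG
  have hG := GN_abs_le N (Real.exp_pos (-u)).le
  rw [abs_mul, abs_of_pos (Real.exp_pos _)]
  have hN : (0:ℝ) ≤ N := Nat.cast_nonneg _
  rcases le_or_gt u 0 with hu | hu
  · rw [indicator_of_mem (by exact hu), indicator_of_notMem (by simpa using hu), add_zero]
    have h3 : Real.exp (σ * u) ≤ 1 := Real.exp_le_one_iff.mpr (by nlinarith)
    have h4 := Real.exp_pos (σ * u)
    constructor
    · nlinarith [hG.2, abs_nonneg (GN N (Real.exp (-u)))]
    · rw [mul_comm]; exact mul_le_mul_of_nonneg_right hG.2 h4.le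
  · rw [indicator_of_notMem (by simpa using hu), indicator_of_mem (by exact hu), zero_add]
    have h5 : Real.exp (σ * u) * |GN N (Real.exp (-u))| ≤ Real.exp ((σ - 1) * u) := by
      calc _ ≤ Real.exp (σ * u) * Real.exp (-u) := by gcongr; exact hG.1
        _ = _ := by rw [← Real.exp_add]; congr 1; ring
    have h6 : Real.exp ((σ - 1) * u) ≤ 1 := Real.exp_le_one_iff.mpr (by nlinarith)
    exact ⟨by linarith, h5⟩

lemma phiG_int {σ : ℝ} (h0 : 0 < σ) (h1 : σ < 1) (N : ℕ) : Integrable (phiG σ N) := by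
  have hA : Integrable ((Iic (0:ℝ)).indicator (fun u : ℝ => (N + 1 : ℝ) * Real.exp (σ * u))) := by
    rw [integrable_indicator_iff measurableSet_Iic]
    exact (integrableOn_exp_mul_Iic h0 0).const_mul _
  have hB : Integrable ((Ioi (0:ℝ)).indicator (fun u : ℝ => Real.exp ((σ - 1) * u))) := by
    rw [integrable_indicator_iff measurableSet_Ioi]
    exact integrableOn_exp_mul_Ioi (by linarith) 0
  refine (hA.add hB).mono' (phiG_meas σ N).aestronglyMeasurable (Eventually.of_forall fun u => ?_)
  exact (phiG_bound h0 h1 N u).2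

/-- the transform kernel -/
noncomputable def phiH (σ : ℝ) (N : ℕ) (h u : ℝ) : ℝ :=
  Real.exp (σ * u) * (GN N (Real.exp (-u) * Real.exp h) - GN N (Real.exp (-u)))

lemma phiH_eq (σ : ℝ) (N : ℕ) (h u : ℝ) :
    phiH σ N h u = Real.exp (σ * h) * phiG σ N (u - h) - phiG σ N u := by
  unfold phiH phiG
  rw [← Real.exp_add, mul_sub, ← mul_assoc, ← Real.exp_add]
  congr 3 <;> ring_nf

lemma phiH_int {σ : ℝ} (h0 : 0 < σ) (h1 : σ < 1) (N : ℕ) (h : ℝ) : Integrable (phiH σ N h) := by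
  have : phiH σ N h = fun u => Real.exp (σ * h) * phiG σ N (u - h) - phiG σ N u := by
    ext u; exact phiH_eq σ N h u
  rw [this]
  exact (((phiG_int h0 h1 N).comp_sub_right h).const_mul _).sub (phiG_int h0 h1 N)

lemma phiH_bdd {σ : ℝ} (h0 : 0 < σ) (h1 : σ < 1) (N : ℕ) (h u : ℝ) :
    |phiH σ N h u| ≤ Real.exp (σ * h) * (N + 1) + (N + 1) := by
  rw [phiH_eq]
  refine (abs_sub _ _).trans ?_
  rw [abs_mul, abs_of_pos (Real.exp_pos _)]
  gcongr
  · exact (phiG_bound h0 h1 N _).1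
  · exact (phiG_bound h0 h1 N _).1

lemma phiH_sq_int {σ : ℝ} (h0 : 0 < σ) (h1 : σ < 1) (N : ℕ) (h : ℝ) :
    Integrable (fun u => (phiH σ N h u) ^ 2) := by
  have := (phiH_int h0 h1 N h).bdd_mul (c := Real.exp (σ * h) * (N + 1) + (N + 1))
    (phiH_int h0 h1 N h).1 (Eventually.of_forall fun u => phiH_bdd h0 h1 N h u)
  simpa [sq] using this

set_option maxHeartbeats 1000000 in
lemma phiH_sq_le {σ₁ σ σ₂ : ℝ} (hσ₁ : 1 / 2 < σ₁) (h1 : σ₁ ≤ σ) (h2 : σ ≤ σ₂) (hσ₂ : σ₂ < 1) (N : ℕ)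
    {T : ℝ} (hT : 1 ≤ T) (hTN : N + 1 ≤ T) (u : ℝ) :
    (phiH σ N (1 / T) u) ^ 2 ≤
      (Iic (-Real.log T)).indicator (fun u => Real.exp (2 * σ * u)) u
      + (Ioi (-Real.log T)).indicator (fun u => 8 / T ^ 2 * Real.exp ((2 * σ - 2) * u)) u
      + ∑ n ∈ Finset.Ioc N ⌈4 * T⌉₊, (Ioc (-Real.log n) (1 / T - Real.log n)).indicator
          (fun _ => 54 * (n : ℝ) ^ (-(2 * σ₁))) u := by
  have hT0 : 0 < T := by linarith
  set h := 1 / T with hh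
  have hh0 : 0 < h := by positivity
  have hh1 : h ≤ 1 := by rw [hh, div_le_one hT0]; exact hT
  have hexp : Real.exp h - 1 ≤ 2 * h := by
    have := Real.abs_exp_sub_one_sub_id_le (x := h) (by rw [abs_of_pos hh0]; exact hh1)
    rw [abs_le] at this
    nlinarith [this.2]
  have hexp1 : 1 < Real.exp h := Real.one_lt_exp_iff.mpr hh0
  set x := Real.exp (-u) with hx
  have hx0 : 0 < x := Real.exp_pos _
  set a := Real.exp h with ha
  have hsq : (phiH σ N h u) ^ 2 = Real.exp (2 * σ * u) * (GN N (x * a) - GN N x) ^ 2 := by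
    unfold phiH
    rw [mul_pow, ← Real.exp_nat_mul]; congr 2; push_cast; ring
  have hxa : x ≤ x * a := by nlinarith
  have hfl : ⌊x⌋₊ ≤ ⌊x * a⌋₊ := Nat.floor_mono hxa
  have hEp := Real.exp_pos (2 * σ * u)
  have hCnn : ∀ n ∈ Finset.Ioc N ⌈4 * T⌉₊, 0 ≤ (Ioc (-Real.log n) (h - Real.log n)).indicator
          (fun _ => 54 * (n : ℝ) ^ (-(2 * σ₁))) u := by
    intro n _
    apply indicator_nonneg
    intro _ _; positivity
  rcases le_or_gt u (-Real.log T) with hu | hu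
  · -- large x
    rw [indicator_of_mem (by exact hu), indicator_of_notMem (by simpa using hu), add_zero]
    have hxT : T ≤ x := by
      rw [hx, ← Real.log_le_iff_le_exp hT0]; linarith
    have hNx : N ≤ ⌊x⌋₊ := Nat.le_floor (by linarith)
    have e1 : GN N x = ⌊x⌋₊ - N - x := by unfold GN; rw [Nat.cast_sub hNx]
    have e2 : GN N (x * a) = ⌊x * a⌋₊ - N - x * a := by unfold GN; rw [Nat.cast_sub (hNx.trans hfl)]
    have b1 := Nat.floor_le hx0.le
    have b2 := Nat.lt_floor_add_one x
    have b3 := Nat.floor_le (hx0.le.trans hxa)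
    have b4 := Nat.lt_floor_add_one (x * a)
    have : (GN N (x * a) - GN N x) ^ 2 ≤ 1 := by
      rw [sq_le_one_iff_abs_le_one, e1, e2, abs_le]; constructor <;> linarith
    rw [hsq]
    have := Finset.sum_nonneg hCnn
    nlinarith
  · rw [indicator_of_notMem (by simpa using hu), indicator_of_mem (by exact hu), zero_add]
    have hxT : x ≤ T := by
      rw [hx, ← Real.le_log_iff_exp_le hT0]; linarith
    have hdiff : x * a - x ≤ 2 := by
      have : x * (a - 1) ≤ T * (2 * h) := mul_le_mul hxT hexp (by linarith) hT0.le
      have e : T * (2 * h) = 2 := by rw [hh]; field_simp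
      linarith
    set c : ℕ := (⌊x * a⌋₊ - N) - (⌊x⌋₊ - N) with hc
    have hcle : (c : ℝ) ≤ 3 := by
      have : ⌊x * a⌋₊ ≤ ⌊x⌋₊ + 3 := by
        have h1 := Nat.floor_le (hx0.le.trans hxa)
        have h2 := Nat.lt_floor_add_one x
        have : (⌊x * a⌋₊ : ℝ) ≤ (⌊x⌋₊ + 3 : ℕ) := by push_cast; linarith
        exact_mod_cast this
      exact_mod_cast (by omega : c ≤ 3)
    have hc0 : (0:ℝ) ≤ c := Nat.cast_nonneg _
    have hg : GN N (x * a) - GN N x = c - x * (a - 1) := by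
      have hm : ⌊x⌋₊ ≤ ⌊x * a⌋₊ := Nat.floor_le_floor hxa
      have hcc : ((⌊x * a⌋₊ - N : ℕ) : ℝ) = c + ((⌊x⌋₊ - N : ℕ) : ℝ) := by
        exact_mod_cast (by omega : ⌊x * a⌋₊ - N = c + (⌊x⌋₊ - N))
      unfold GN
      rw [hcc]; ring
    have hcard : c ≤ ((Finset.Ioc N ⌈4 * T⌉₊).filter (fun n : ℕ => x < n ∧ (n:ℝ) ≤ x * a)).card := by
      have : c = (Finset.Ioc (max N ⌊x⌋₊) ⌊x * a⌋₊).card := by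
        rw [Nat.card_Ioc]; omega
      rw [this]
      apply Finset.card_le_card
      intro n hn
      rw [Finset.mem_Ioc] at hn
      have h1 : ⌊x⌋₊ < n := lt_of_le_of_lt (le_max_right _ _) hn.1
      have h2 : N < n := lt_of_le_of_lt (le_max_left _ _) hn.1
      have h3 : (n:ℝ) ≤ x * a := (Nat.le_floor_iff (hx0.le.trans hxa)).mp hn.2
      have h4 : n ≤ ⌈4 * T⌉₊ := by
        have : (n:ℝ) ≤ ⌈4 * T⌉₊ := by
          refine le_trans ?_ (Nat.le_ceil _)
          linarith
        exact_mod_cast this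
      rw [Finset.mem_filter, Finset.mem_Ioc]
      exact ⟨⟨h2, h4⟩, (Nat.floor_lt hx0.le).mp h1, h3⟩
    have hsum : Real.exp (2 * σ * u) * (6 * c) ≤ ∑ n ∈ Finset.Ioc N ⌈4 * T⌉₊,
        (Ioc (-Real.log n) (h - Real.log n)).indicator (fun _ => 54 * (n : ℝ) ^ (-(2 * σ₁))) u := by
      calc Real.exp (2 * σ * u) * (6 * c)
          ≤ Real.exp (2 * σ * u) * (6 * ((Finset.Ioc N ⌈4 * T⌉₊).filter (fun n : ℕ => x < n ∧ (n:ℝ) ≤ x * a)).card) := by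
            gcongr
        _ = ∑ n ∈ (Finset.Ioc N ⌈4 * T⌉₊).filter (fun n : ℕ => x < n ∧ (n:ℝ) ≤ x * a), 6 * Real.exp (2 * σ * u) := by
            rw [Finset.sum_const, nsmul_eq_mul]; ring
        _ ≤ ∑ n ∈ (Finset.Ioc N ⌈4 * T⌉₊).filter (fun n : ℕ => x < n ∧ (n:ℝ) ≤ x * a),
            (Ioc (-Real.log n) (h - Real.log n)).indicator (fun _ => 54 * (n : ℝ) ^ (-(2 * σ₁))) u := by
            apply Finset.sum_le_sum
            intro n hn
            rw [Finset.mem_filter, Finset.mem_Ioc] at hn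
            obtain ⟨⟨hn1, hn2⟩, hn3, hn4⟩ := hn
            have hnpos : (0:ℝ) < n := by linarith
            have hn1' : (1:ℝ) ≤ n := by exact_mod_cast (by omega : 1 ≤ n)
            have m1 : -Real.log n < u := by
              have : -u < Real.log n := (Real.lt_log_iff_exp_lt hnpos).mpr hn3
              linarith
            have m2 : u ≤ h - Real.log n := by
              have : x * a = Real.exp (-u + h) := by rw [Real.exp_add]
              rw [this] at hn4
              have := (Real.log_le_iff_le_exp hnpos).mpr hn4
              linarith
            rw [indicator_of_mem (by exact ⟨m1, m2⟩)]
            have hlog : 0 ≤ Real.log n := Real.log_nonneg hn1'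
            have : Real.exp (2 * σ * u) ≤ Real.exp 2 * (n : ℝ) ^ (-(2 * σ₁)) := by
              rw [Real.rpow_def_of_pos hnpos, ← Real.exp_add]
              apply Real.exp_le_exp.mpr
              nlinarith
            have he : Real.exp 2 ≤ 9 := by
              have h3 := Real.exp_one_lt_d9
              have : Real.exp 2 = Real.exp 1 * Real.exp 1 := by rw [← Real.exp_add]; norm_num
              rw [this]; nlinarith [Real.exp_pos 1]
            have hp : (0:ℝ) ≤ (n : ℝ) ^ (-(2 * σ₁)) := by positivity
            nlinarith
        _ ≤ _ := Finset.sum_le_sum_of_subset_of_nonneg (Finset.filter_subset _ _) (fun n hn _ => hCnn n hn)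
    have hB : Real.exp (2 * σ * u) * (2 * (x * (a - 1)) ^ 2) ≤ 8 / T ^ 2 * Real.exp ((2 * σ - 2) * u) := by
      have h1 : (x * (a - 1)) ^ 2 ≤ (x * (2 * h)) ^ 2 := by
        have : 0 ≤ x * (a - 1) := mul_nonneg hx0.le (by linarith)
        gcongr
      have h2 : Real.exp ((2 * σ - 2) * u) = Real.exp (2 * σ * u) * x ^ 2 := by
        rw [hx, ← Real.exp_nat_mul, ← Real.exp_add]; congr 1; push_cast; ring
      rw [h2]
      have : 8 / T ^ 2 * (Real.exp (2 * σ * u) * x ^ 2) = Real.exp (2 * σ * u) * (2 * (x * (2 * h)) ^ 2) := by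
        have h8 : 8 / T ^ 2 = 8 * h ^ 2 := by rw [hh, one_div, inv_pow]; rfl
        rw [h8]; ring
      rw [this]
      exact mul_le_mul_of_nonneg_left (mul_le_mul_of_nonneg_left h1 (by norm_num)) hEp.le
    rw [hsq, hg]
    have : Real.exp (2 * σ * u) * (c - x * (a - 1)) ^ 2 ≤
        Real.exp (2 * σ * u) * (6 * c) + Real.exp (2 * σ * u) * (2 * (x * (a - 1)) ^ 2) := by
      rw [← mul_add]
      apply mul_le_mul_of_nonneg_left _ hEp.le
      nlinarith [sq_nonneg (c + x * (a - 1))]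
    linarith

lemma phiH_sq_integral {σ₁ σ σ₂ : ℝ} (hσ₁ : 1 / 2 < σ₁) (h1 : σ₁ ≤ σ) (h2 : σ ≤ σ₂) (hσ₂ : σ₂ < 1) (N : ℕ)
    {T : ℝ} (hT : 1 ≤ T) (hTN : N + 1 ≤ T) :
    ∫ u, (phiH σ N (1 / T) u) ^ 2 ≤
      (1 + 8 / (2 - 2 * σ₂)) * T ^ (-(2 * σ₁)) + 54 / T * ∑ n ∈ Finset.Ioc N ⌈4 * T⌉₊, (n : ℝ) ^ (-(2 * σ₁)) := by
  have hT0 : 0 < T := by linarith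
  have hA : Integrable ((Iic (-Real.log T)).indicator (fun u => Real.exp (2 * σ * u))) := by
    rw [integrable_indicator_iff measurableSet_Iic]
    exact integrableOn_exp_mul_Iic (by linarith) _
  have hB : Integrable ((Ioi (-Real.log T)).indicator (fun u => 8 / T ^ 2 * Real.exp ((2 * σ - 2) * u))) := by
    rw [integrable_indicator_iff measurableSet_Ioi]
    exact (integrableOn_exp_mul_Ioi (by linarith) _).const_mul _
  have hC : ∀ n ∈ Finset.Ioc N ⌈4 * T⌉₊, Integrable ((Ioc (-Real.log n) (1 / T - Real.log n)).indicator
          (fun _ => 54 * (n : ℝ) ^ (-(2 * σ₁)))) := by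
    intro n _
    rw [integrable_indicator_iff measurableSet_Ioc]
    exact integrableOn_const (by simp)
  have hCs := integrable_finsetSum _ hC
  calc ∫ u, (phiH σ N (1 / T) u) ^ 2
      ≤ ∫ u, ((Iic (-Real.log T)).indicator (fun u => Real.exp (2 * σ * u)) u
      + (Ioi (-Real.log T)).indicator (fun u => 8 / T ^ 2 * Real.exp ((2 * σ - 2) * u)) u
      + ∑ n ∈ Finset.Ioc N ⌈4 * T⌉₊, (Ioc (-Real.log n) (1 / T - Real.log n)).indicator
          (fun _ => 54 * (n : ℝ) ^ (-(2 * σ₁))) u) :=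
        integral_mono (phiH_sq_int (by linarith) (by linarith) N _) ((hA.add hB).add hCs)
          (fun u => phiH_sq_le hσ₁ h1 h2 hσ₂ N hT hTN u)
    _ = Real.exp (2 * σ * (-Real.log T)) / (2 * σ) + 8 / T ^ 2 * (-Real.exp ((2 * σ - 2) * (-Real.log T)) / (2 * σ - 2))
        + ∑ n ∈ Finset.Ioc N ⌈4 * T⌉₊, (1 / T) * (54 * (n : ℝ) ^ (-(2 * σ₁))) := by
        have hAB : Integrable (fun u => (Iic (-Real.log T)).indicator (fun u => Real.exp (2 * σ * u)) u
          + (Ioi (-Real.log T)).indicator (fun u => 8 / T ^ 2 * Real.exp ((2 * σ - 2) * u)) u) := hA.add hB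
        rw [integral_add hAB hCs, integral_add hA hB, integral_indicator measurableSet_Iic,
          integral_indicator measurableSet_Ioi, integral_exp_mul_Iic (by linarith), integral_const_mul,
          integral_exp_mul_Ioi (by linarith), integral_finsetSum _ hC]
        congr 1
        refine Finset.sum_congr rfl fun n _ => ?_
        rw [integral_indicator measurableSet_Ioc, setIntegral_const, Real.volume_real_Ioc]
        have : 1 / T - Real.log n - -Real.log n = 1 / T := by ring
        rw [this, max_eq_left (by positivity), smul_eq_mul]
    _ ≤ _ := by
        have e1 : Real.exp (2 * σ * (-Real.log T)) = T ^ (-(2 * σ)) := by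
          rw [Real.rpow_def_of_pos hT0]; congr 1; ring
        have e2 : Real.exp ((2 * σ - 2) * (-Real.log T)) = T ^ 2 * T ^ (-(2 * σ)) := by
          rw [Real.rpow_def_of_pos hT0]
          have : T ^ 2 = Real.exp (2 * Real.log T) := by
            rw [show (2 * Real.log T) = Real.log T + Real.log T by ring, Real.exp_add, Real.exp_log hT0, sq]
          rw [this, ← Real.exp_add]; congr 1; ring
        have e3 : T ^ (-(2 * σ)) ≤ T ^ (-(2 * σ₁)) := Real.rpow_le_rpow_of_exponent_le hT (by linarith)
        have e0 : 0 ≤ T ^ (-(2 * σ)) := by positivity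
        have s1 : T ^ (-(2 * σ)) / (2 * σ) ≤ T ^ (-(2 * σ₁)) := by
          rw [div_le_iff₀ (by linarith)]; nlinarith
        have s2 : 8 / T ^ 2 * (-(T ^ 2 * T ^ (-(2 * σ))) / (2 * σ - 2)) = 8 * T ^ (-(2 * σ)) / (2 - 2 * σ) := by
          have : 2 * σ - 2 ≠ 0 := by intro h; linarith
          have : 2 - 2 * σ ≠ 0 := by intro h; linarith
          field_simp
          ring_nf
          rw [show (1 - σ) = -(-1 + σ) by ring, inv_neg]
        have s3 : 8 * T ^ (-(2 * σ)) / (2 - 2 * σ) ≤ 8 / (2 - 2 * σ₂) * T ^ (-(2 * σ₁)) := by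
          rw [div_mul_eq_mul_div]
          apply div_le_div₀ (by positivity) (by linarith) (by linarith) (by linarith)
        rw [e1, e2, s2]
        have s4 : ∑ n ∈ Finset.Ioc N ⌈4 * T⌉₊, (1 / T) * (54 * (n : ℝ) ^ (-(2 * σ₁)))
            = 54 / T * ∑ n ∈ Finset.Ioc N ⌈4 * T⌉₊, (n : ℝ) ^ (-(2 * σ₁)) := by
          rw [Finset.mul_sum]; refine Finset.sum_congr rfl fun n _ => by ring
        rw [s4, add_mul, one_mul]
        linarith


noncomputable def zN (N : ℕ) (s : ℂ) : ℂ := ∑ n ∈ Finset.Icc 1 N, (n:ℂ) ^ (-s)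

lemma fourier_phiG {σ : ℝ} (h0 : 0 < σ) (h1 : σ < 1) (N : ℕ) (t : ℝ) :
    ∫ u : ℝ, (phiG σ N u : ℂ) * cexp (I * t * u) =
      (riemannZeta (σ + t * I) - zN N (σ + t * I)) / (σ + t * I) := by
  have hre : ((σ:ℂ) + t * I).re = σ := by simp
  have him : ((σ:ℂ) + t * I).im = t := by simp
  have h := (hasMellin_GN N (s := σ + t * I) (by rw [hre]; exact h0) (by rw [hre]; exact h1)).2
  unfold zN
  rw [← h, mellin_eq_fourier, Real.fourier_real_eq_integral_exp_smul]
  congr 1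
  ext u
  rw [neg_re, neg_im, hre, him, neg_neg, smul_eq_mul, Complex.real_smul, ← Complex.ofReal_mul, mul_comm]
  unfold phiG
  congr 2
  push_cast
  have : (Real.pi : ℂ) ≠ 0 := by exact_mod_cast Real.pi_ne_zero
  field_simp

lemma fourier_phiH {σ : ℝ} (h0 : 0 < σ) (h1 : σ < 1) (N : ℕ) (h t : ℝ) :
    ∫ u : ℝ, (phiH σ N h u : ℂ) * cexp (I * t * u) =
      (cexp (h * (σ + t * I)) - 1) * ((riemannZeta (σ + t * I) - zN N (σ + t * I)) / (σ + t * I)) := by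
  rw [← fourier_phiG h0 h1]
  have hG : Integrable (fun u : ℝ => (phiG σ N u : ℂ) * cexp (I * t * u)) := by
    refine (phiG_int h0 h1 N).ofReal.mul_bdd (c := 1) (by fun_prop) ?_
    refine Eventually.of_forall fun u => ?_
    rw [mul_assoc, ← ofReal_mul, mul_comm, Complex.norm_exp_ofReal_mul_I]
  have e : ∀ u : ℝ, (phiH σ N h u : ℂ) * cexp (I * t * u) =
      cexp (h * (σ + t * I)) * ((phiG σ N (u - h) : ℂ) * cexp (I * t * ((u - h : ℝ) : ℂ)))
        - (phiG σ N u : ℂ) * cexp (I * t * u) := by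
    intro u
    rw [phiH_eq]
    push_cast
    rw [sub_mul]
    congr 1
    rw [mul_comm (cexp (h * (σ + t * I))), mul_assoc (phiG σ N (u - h) : ℂ), ← Complex.exp_add, mul_comm (cexp _), mul_assoc,
      ← Complex.exp_add]
    congr 2; ring
  simp_rw [e]
  rw [integral_sub ((hG.comp_sub_right h).const_mul _) hG, integral_const_mul,
    integral_sub_right_eq_self (fun u : ℝ => (phiG σ N u : ℂ) * cexp (I * t * u)) h]
  ring

lemma sin_ge_half {x : ℝ} (h1 : 9 / 10 ≤ x) (h2 : x ≤ 21 / 10) : 1 / 2 ≤ Real.sin x := by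
  have p1 := Real.pi_gt_d2
  have p2 := Real.pi_lt_d2
  have key : ∀ y : ℝ, 9 / 10 ≤ y → y ≤ Real.pi / 2 → 1 / 2 ≤ Real.sin y := by
    intro y a b
    refine le_trans ?_ (Real.mul_le_sin (by linarith) b)
    rw [div_mul_eq_mul_div, le_div_iff₀ Real.pi_pos]
    linarith
  by_cases hx : x ≤ Real.pi / 2
  · exact key x h1 hx
  · rw [← Real.sin_pi_sub]
    exact key _ (by linarith) (by linarith)

lemma pointwise_F {σ : ℝ} (h0 : 0 < σ) (h1 : σ < 1) (N : ℕ) {T t : ℝ} (hT : 10 ≤ T)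
    (ht1 : T - 1 ≤ t) (ht2 : t ≤ 2 * T + 1) :
    ‖riemannZeta (σ + t * I) - zN N (σ + t * I)‖ ^ 2 ≤ 36 * Real.exp 9 * T ^ 2 *
      (‖∫ u : ℝ, (phiH σ N (1 / T) u : ℂ) * cexp (I * t * u)‖ ^ 2 * Real.exp (-(1 / T ^ 2) * t ^ 2)) := by
  have hT0 : 0 < T := by linarith
  have htp : 0 < t := by linarith
  have hx1 : 9 / 10 ≤ 1 / T * t := by
    rw [one_div_mul_eq_div, le_div_iff₀ hT0]; linarith
  have hx2 : 1 / T * t ≤ 21 / 10 := by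
    rw [one_div_mul_eq_div, div_le_iff₀ hT0]; linarith
  have hs := sin_ge_half hx1 hx2
  rw [fourier_phiH h0 h1]
  set s : ℂ := σ + t * I with hsdef
  set F := riemannZeta s - zN N s
  have hA : 1 / 2 ≤ ‖cexp ((1 / T : ℝ) * s) - 1‖ := by
    refine le_trans ?_ (Complex.abs_im_le_norm _)
    refine le_trans ?_ (le_abs_self _)
    rw [sub_im, one_im, sub_zero, Complex.exp_im]
    have e1 : (((1 / T : ℝ) : ℂ) * s).re = 1 / T * σ := by rw [re_ofReal_mul, hsdef]; simp
    have e2 : (((1 / T : ℝ) : ℂ) * s).im = 1 / T * t := by rw [im_ofReal_mul, hsdef]; simp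
    rw [e1, e2]
    have : 1 ≤ Real.exp (1 / T * σ) := Real.one_le_exp (by positivity)
    nlinarith
  have hsn : ‖s‖ ≤ 3 * T := by
    refine (norm_add_le _ _).trans ?_
    rw [norm_mul, norm_I, norm_real, norm_real, Real.norm_eq_abs, Real.norm_eq_abs, abs_of_pos h0, abs_of_pos htp]
    linarith
  have hs0 : 0 < ‖s‖ := by
    rw [norm_pos_iff]; intro h
    have : s.re = σ := by rw [hsdef]; simp
    rw [h] at this; simp at this; linarith
  have hF : ‖F‖ ≤ 6 * T * ‖(cexp ((1 / T : ℝ) * s) - 1) * (F / s)‖ := by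
    rw [norm_mul, norm_div]
    have h3 : ‖F‖ / (3 * T) ≤ ‖F‖ / ‖s‖ := div_le_div_of_nonneg_left (norm_nonneg _) hs0 hsn
    have h4 : 1 / 2 * (‖F‖ / (3 * T)) ≤ ‖cexp ((1 / T : ℝ) * s) - 1‖ * (‖F‖ / ‖s‖) :=
      mul_le_mul hA h3 (by positivity) (norm_nonneg _)
    calc ‖F‖ = 6 * T * (1 / 2 * (‖F‖ / (3 * T))) := by field_simp; ring
      _ ≤ _ := mul_le_mul_of_nonneg_left h4 (by positivity)
  have he : 1 ≤ Real.exp 9 * Real.exp (-(1 / T ^ 2) * t ^ 2) := by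
    rw [← Real.exp_add]; apply Real.one_le_exp
    have : 1 / T ^ 2 * t ^ 2 = (1 / T * t) ^ 2 := by ring
    nlinarith
  set m := ‖(cexp ((1 / T : ℝ) * s) - 1) * (F / s)‖
  calc ‖F‖ ^ 2 ≤ (6 * T * m) ^ 2 := by gcongr
    _ = 36 * T ^ 2 * m ^ 2 * 1 := by ring
    _ ≤ 36 * T ^ 2 * m ^ 2 * (Real.exp 9 * Real.exp (-(1 / T ^ 2) * t ^ 2)) := by gcongr
    _ = _ := by ring

lemma zN_cont (N : ℕ) : Continuous (zN N) := by
  unfold zN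
  refine continuous_finsetSum _ fun n hn => ?_
  have : (n:ℂ) ≠ 0 := by
    have := (Finset.mem_Icc.mp hn).1
    exact_mod_cast (by omega : n ≠ 0)
  exact Continuous.const_cpow continuous_neg (Or.inl this)

lemma zeta_line_cont {σ : ℝ} (h1 : σ ≠ 1) : Continuous (fun t : ℝ => riemannZeta (σ + t * I)) := by
  rw [continuous_iff_continuousAt]
  intro t
  have hne : (σ:ℂ) + t * I ≠ 1 := by
    intro h
    have := congrArg Complex.re h
    simp at this; exact h1 this
  exact ContinuousAt.comp (f := fun t : ℝ => (σ:ℂ) + t * I) (differentiableAt_riemannZeta hne).continuousAt (by fun_prop)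

lemma meansq_pre {σ : ℝ} (h0 : 0 < σ) (h1 : σ < 1) (N : ℕ) {T : ℝ} (hT : 10 ≤ T) :
    ∫ t in (T - 1)..(2 * T + 1), ‖riemannZeta (σ + t * I) - zN N (σ + t * I)‖ ^ 2 ≤
      (36 * Real.exp 9 * (2 * Real.pi)) * T ^ 2 * ∫ u, (phiH σ N (1 / T) u) ^ 2 := by
  have hT0 : 0 < T := by linarith
  have hsq : ∀ u, ‖(phiH σ N (1 / T) u : ℂ)‖ ^ 2 = (phiH σ N (1 / T) u) ^ 2 := by
    intro u; rw [norm_real, Real.norm_eq_abs, sq_abs]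
  have gp := gauss_planch (fun u => (phiH σ N (1 / T) u : ℂ)) (phiH_int h0 h1 N _).ofReal
    (by simp_rw [hsq]; exact phiH_sq_int h0 h1 N _) (b := 1 / T ^ 2) (by positivity)
  simp_rw [hsq] at gp
  obtain ⟨g1, g2⟩ := gp
  have hc : Continuous (fun t : ℝ => ‖riemannZeta (σ + t * I) - zN N (σ + t * I)‖ ^ 2) := by
    refine (((zeta_line_cont h1.ne).sub ((zN_cont N).comp ?_)).norm).pow 2
    fun_prop
  have hle : T - 1 ≤ 2 * T + 1 := by linarith
  rw [intervalIntegral.integral_of_le hle]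
  calc ∫ t in Ioc (T - 1) (2 * T + 1), ‖riemannZeta (σ + t * I) - zN N (σ + t * I)‖ ^ 2
      ≤ ∫ t in Ioc (T - 1) (2 * T + 1), 36 * Real.exp 9 * T ^ 2 *
      (‖∫ u : ℝ, (phiH σ N (1 / T) u : ℂ) * cexp (I * t * u)‖ ^ 2 * Real.exp (-(1 / T ^ 2) * t ^ 2)) := by
        refine setIntegral_mono_on ?_ (g1.const_mul _).integrableOn measurableSet_Ioc ?_
        · exact (hc.integrableOn_Icc).mono_set Ioc_subset_Icc_self
        · intro t ht
          exact pointwise_F h0 h1 N hT ht.1.le ht.2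
    _ ≤ ∫ t : ℝ, 36 * Real.exp 9 * T ^ 2 *
      (‖∫ u : ℝ, (phiH σ N (1 / T) u : ℂ) * cexp (I * t * u)‖ ^ 2 * Real.exp (-(1 / T ^ 2) * t ^ 2)) := by
        refine setIntegral_le_integral (g1.const_mul _) (Eventually.of_forall fun t => ?_)
        positivity
    _ ≤ _ := by
        rw [integral_const_mul]
        calc _ ≤ 36 * Real.exp 9 * T ^ 2 * (2 * Real.pi * ∫ u, (phiH σ N (1 / T) u) ^ 2) := by
              gcongr
          _ = _ := by ring

theorem meansq {σ₁ σ₂ : ℝ} (hσ₁ : 1 / 2 < σ₁) (hσ₂ : σ₂ < 1) {ε : ℝ} (hε : 0 < ε) :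
    ∃ N0 : ℕ, ∀ N ≥ N0, ∃ T0 : ℝ, ∀ T ≥ T0, ∀ σ : ℝ, σ₁ ≤ σ → σ ≤ σ₂ →
      ∫ t in (T - 1)..(2 * T + 1), ‖riemannZeta (σ + t * I) - zN N (σ + t * I)‖ ^ 2 ≤ ε * T := by
  set K : ℝ := 36 * Real.exp 9 * (2 * Real.pi) with hK
  have hK0 : 0 < K := by have := Real.pi_pos; positivity
  have hsum : Summable (fun n : ℕ => (n:ℝ) ^ (-(2 * σ₁))) := Real.summable_nat_rpow.mpr (by linarith)
  obtain ⟨s, hs⟩ := (summable_iff_vanishing_norm.mp hsum) (ε / (108 * K)) (by positivity)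
  refine ⟨s.sup id, fun N hN => ?_⟩
  have htail : ∀ M : ℕ, ∑ n ∈ Finset.Ioc N M, (n:ℝ) ^ (-(2 * σ₁)) ≤ ε / (108 * K) := by
    intro M
    refine (le_abs_self _).trans (hs _ ?_).le
    rw [Finset.disjoint_left]
    intro n hn hns
    have h1 := (Finset.mem_Ioc.mp hn).1
    have h2 : n ≤ s.sup id := Finset.le_sup (f := id) hns
    omega
  have hlim : Tendsto (fun T : ℝ => K * |1 + 8 / (2 - 2 * σ₂)| * T ^ (-(2 * σ₁ - 1))) atTop (𝓝 (K * |1 + 8 / (2 - 2 * σ₂)| * 0)) :=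
    (tendsto_rpow_neg_atTop (by linarith)).const_mul _
  rw [mul_zero] at hlim
  obtain ⟨T1, hT1⟩ := eventually_atTop.mp (hlim.eventually (gt_mem_nhds (show 0 < ε / 2 by linarith)))
  refine ⟨max T1 (max 10 (N + 1)), fun T hT σ ha hb => ?_⟩
  have hTa : T1 ≤ T := le_trans (le_max_left _ _) hT
  have hTb : 10 ≤ T := le_trans (le_trans (le_max_left _ _) (le_max_right _ _)) hT
  have hTc : (N:ℝ) + 1 ≤ T := le_trans (le_trans (le_max_right _ _) (le_max_right _ _)) hT
  have hT0 : 0 < T := by linarith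
  refine (meansq_pre (by linarith) (by linarith) N hTb).trans ?_
  have h3 := phiH_sq_integral hσ₁ ha hb hσ₂ N (by linarith) hTc
  have h4 := htail ⌈4 * T⌉₊
  have h5 := hT1 T hTa
  have e1 : T ^ (-(2 * σ₁)) * T = T ^ (-(2 * σ₁ - 1)) := by
    nth_rewrite 2 [← Real.rpow_one T]
    rw [← Real.rpow_add hT0]; congr 1; ring
  have hp : 0 ≤ T ^ (-(2 * σ₁)) := by positivity
  rw [← hK]
  calc K * T ^ 2 * ∫ u, (phiH σ N (1 / T) u) ^ 2
      ≤ K * T ^ 2 * (|1 + 8 / (2 - 2 * σ₂)| * T ^ (-(2 * σ₁)) + 54 / T * (ε / (108 * K))) := by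
        refine mul_le_mul_of_nonneg_left (h3.trans (add_le_add ?_ ?_)) (by positivity)
        · exact mul_le_mul_of_nonneg_right (le_abs_self _) hp
        · exact mul_le_mul_of_nonneg_left h4 (by positivity)
    _ = T * (K * |1 + 8 / (2 - 2 * σ₂)| * (T ^ (-(2 * σ₁)) * T)) + ε / 2 * T := by
        field_simp; ring
    _ ≤ T * (ε / 2) + ε / 2 * T := by
        rw [e1]; gcongr
    _ = ε * T := by ring


/-- mean values of trigonometric polynomials -/
lemma dp_mean {ι : Type*} [DecidableEq ι] (s : Finset ι) (l : ι → ℝ) (hl : Set.InjOn l s) :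
    ∃ C : ℝ, ∀ b : ι → ℂ, (∀ i ∈ s, ‖b i‖ ≤ 1) → ∀ T : ℝ,
      |(∫ t in T..(2 * T), ‖∑ i ∈ s, b i * cexp (((-(l i) * t : ℝ) : ℂ) * I)‖ ^ 2) - T * ∑ i ∈ s, ‖b i‖ ^ 2| ≤ C := by
  refine ⟨∑ i ∈ s, ∑ j ∈ s, 2 / |l i - l j|, fun b hb T => ?_⟩
  have e1 : ∀ t : ℝ, ((‖∑ i ∈ s, b i * cexp (((-(l i) * t : ℝ) : ℂ) * I)‖ ^ 2 : ℝ) : ℂ) =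
      ∑ i ∈ s, ∑ j ∈ s, b i * (starRingEnd ℂ) (b j) * cexp ((-(l i - l j : ℝ) * I : ℂ) * t) := by
    intro t
    rw [ofReal_pow, ← Complex.mul_conj', map_sum, Finset.sum_mul_sum]
    refine Finset.sum_congr rfl fun i _ => Finset.sum_congr rfl fun j _ => ?_
    rw [map_mul, ← Complex.exp_conj, map_mul, conj_I, conj_ofReal]
    rw [mul_mul_mul_comm, ← Complex.exp_add]
    congr 2
    push_cast; ring
  have e2 : ((∫ t in T..(2 * T), ‖∑ i ∈ s, b i * cexp (((-(l i) * t : ℝ) : ℂ) * I)‖ ^ 2 : ℝ) : ℂ) =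
      ∑ i ∈ s, ∑ j ∈ s, b i * (starRingEnd ℂ) (b j) * ∫ t in T..(2 * T), cexp ((-(l i - l j : ℝ) * I : ℂ) * t) := by
    rw [← intervalIntegral.integral_ofReal]
    simp_rw [e1]
    rw [intervalIntegral.integral_finsetSum]
    · refine Finset.sum_congr rfl fun i _ => ?_
      rw [intervalIntegral.integral_finsetSum]
      · refine Finset.sum_congr rfl fun j _ => ?_
        rw [intervalIntegral.integral_const_mul]
      · intro j _
        apply Continuous.intervalIntegrable
        fun_prop
    · intro j _
      apply Continuous.intervalIntegrable
      fun_prop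
  have e3 : ((T * ∑ i ∈ s, ‖b i‖ ^ 2 : ℝ) : ℂ) = ∑ i ∈ s, ∑ j ∈ s, if i = j then (T : ℂ) * (b i * (starRingEnd ℂ) (b j)) else 0 := by
    push_cast
    rw [Finset.mul_sum]
    refine Finset.sum_congr rfl fun i hi => ?_
    rw [Finset.sum_ite_eq, if_pos hi, Complex.mul_conj']
  rw [← Real.norm_eq_abs, ← norm_real, ofReal_sub, e2, e3, ← Finset.sum_sub_distrib]
  refine (norm_sum_le _ _).trans (Finset.sum_le_sum fun i hi => ?_)
  rw [← Finset.sum_sub_distrib]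
  refine (norm_sum_le _ _).trans (Finset.sum_le_sum fun j hj => ?_)
  by_cases hij : i = j
  · subst hij
    simp
    rw [show (2 * (T:ℂ) - T) = T by ring, mul_comm, sub_self]
  · rw [if_neg hij, sub_zero, norm_mul, norm_mul]
    have hne : l i - l j ≠ 0 := by
      intro h; exact hij (hl hi hj (by linarith))
    have hne' : (-(l i - l j : ℝ) * I : ℂ) ≠ 0 := by
      refine mul_ne_zero (neg_ne_zero.mpr ?_) I_ne_zero
      exact_mod_cast hne
    rw [integral_exp_mul_complex hne', norm_div]
    have n1 : ∀ x : ℝ, ‖cexp ((-(l i - l j : ℝ) * I : ℂ) * x)‖ = 1 := by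
      intro x
      rw [show (-(l i - l j : ℝ) * I : ℂ) * x = ((-(l i - l j) * x : ℝ) : ℂ) * I by push_cast; ring,
        norm_exp_ofReal_mul_I]
    have n2 : ‖(-(l i - l j : ℝ) * I : ℂ)‖ = |l i - l j| := by
      rw [norm_mul, norm_I, norm_neg, norm_real, mul_one, Real.norm_eq_abs]
    rw [n2, Complex.norm_conj]
    have n3 : ‖cexp ((-(l i - l j : ℝ) * I : ℂ) * (2 * T : ℝ)) - cexp ((-(l i - l j : ℝ) * I : ℂ) * T)‖ ≤ 2 := by
      refine (norm_sub_le _ _).trans ?_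
      rw [n1, n1]; norm_num
    calc ‖b i‖ * ‖b j‖ * _ ≤ 1 * (2 / |l i - l j|) := by
          refine mul_le_mul ?_ ?_ (by positivity) zero_le_one
          · exact mul_le_one₀ (hb i hi) (norm_nonneg _) (hb j hj)
          · gcongr
      _ = _ := one_mul _

noncomputable def en (n : ℕ) (t : ℝ) : ℂ := cexp (((-(Real.log n) * t : ℝ) : ℂ) * I)

lemma en_norm (n : ℕ) (t : ℝ) : ‖en n t‖ = 1 := norm_exp_ofReal_mul_I _

lemma en_mul {a b : ℕ} (ha : a ≠ 0) (hb : b ≠ 0) (t : ℝ) : en (a * b) t = en a t * en b t := by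
  unfold en
  rw [← Complex.exp_add]
  congr 1
  rw [Nat.cast_mul, Real.log_mul (by exact_mod_cast ha) (by exact_mod_cast hb)]
  push_cast; ring

lemma en_pow {a : ℕ} (ha : a ≠ 0) (j : ℕ) (t : ℝ) : en (a ^ j) t = en a t ^ j := by
  induction j with
  | zero => simp [en]
  | succ k ih => rw [pow_succ, en_mul (pow_ne_zero _ ha) ha, ih, pow_succ]

lemma en_cont (n : ℕ) : Continuous (en n) := by unfold en; fun_prop

lemma cpow_en {n : ℕ} (hn : n ≠ 0) (z : ℂ) (t : ℝ) : (n:ℂ) ^ (-(z + t * I)) = (n:ℂ) ^ (-z) * en n t := by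
  have h : (n:ℂ) ≠ 0 := by exact_mod_cast hn
  rw [neg_add, Complex.cpow_add _ _ h]
  congr 1
  rw [Complex.cpow_def_of_ne_zero h, en, ← Complex.natCast_log]
  congr 1; push_cast; ring

noncomputable def chi (d : ℕ → ℂ) (k : ℕ) : ℂ := (k.primeFactorsList.map d).prod

lemma chi_mul (d : ℕ → ℂ) {a b : ℕ} (ha : a ≠ 0) (hb : b ≠ 0) : chi d (a * b) = chi d a * chi d b := by
  unfold chi
  rw [((Nat.perm_primeFactorsList_mul ha hb).map d).prod_eq, List.map_append, List.prod_append]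

lemma chi_pow (d : ℕ → ℂ) {p : ℕ} (hp : p.Prime) (j : ℕ) : chi d (p ^ j) = d p ^ j := by
  induction j with
  | zero => simp [chi]
  | succ k ih =>
    rw [pow_succ, chi_mul d (pow_ne_zero _ hp.ne_zero) hp.ne_zero, ih, pow_succ]
    congr 1
    simp [chi, Nat.primeFactorsList_prime hp]

lemma chi_norm {d : ℕ → ℂ} (hd : ∀ p, ‖d p‖ = 1) (k : ℕ) : ‖chi d k‖ = 1 := by
  unfold chi
  induction k.primeFactorsList with
  | nil => simp
  | cons a l ih => simp [hd, ih]

lemma Q_expand (d : ℕ → ℂ) (M : ℕ) (S : Finset ℕ) (hS : ∀ p ∈ S, p.Prime) :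
    ∃ K : Finset ℕ, K.card = M ^ S.card ∧ (∀ k ∈ K, k ≠ 0 ∧ ∀ q : ℕ, q.Prime → q ∣ k → q ∈ S) ∧
      ∀ t : ℝ, ∏ p ∈ S, ∑ j ∈ Finset.range M, (d p * en p t) ^ j = ∑ k ∈ K, chi d k * en k t := by
  induction S using Finset.induction_on with
  | empty =>
    refine ⟨{1}, by simp, ?_, ?_⟩
    · intro k hk
      rw [Finset.mem_singleton] at hk
      subst hk
      refine ⟨one_ne_zero, fun q hq h => ?_⟩
      exact absurd (Nat.dvd_one.mp h) hq.one_lt.ne'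
    · intro t; simp [chi, en]
  | insert p S hpS ih =>
    obtain ⟨K, hK1, hK2, hK3⟩ := ih (fun q hq => hS q (Finset.mem_insert_of_mem hq))
    have hp : p.Prime := hS p (Finset.mem_insert_self _ _)
    have hcop : ∀ k ∈ K, ¬ p ∣ k := fun k hk h => hpS ((hK2 k hk).2 p hp h)
    have hinj : Set.InjOn (fun x : ℕ × ℕ => x.1 * p ^ x.2) ((K ×ˢ Finset.range M : Finset (ℕ × ℕ)) : Set (ℕ × ℕ)) := by
      rintro ⟨k, i⟩ h1 ⟨k', i'⟩ h2 h
      simp only [Finset.coe_product, Set.mem_prod, Finset.mem_coe] at h1 h2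
      simp only at h
      have c1 := hcop k h1.1
      have c2 := hcop k' h2.1
      have e : i = i' := by
        have h3 := congrArg (fun n => padicValNat p n) h
        have := Fact.mk hp
        rw [padicValNat.mul (hK2 k h1.1).1 (pow_ne_zero _ hp.ne_zero),
          padicValNat.mul (hK2 k' h2.1).1 (pow_ne_zero _ hp.ne_zero),
          padicValNat.eq_zero_of_not_dvd c1, padicValNat.eq_zero_of_not_dvd c2,
          padicValNat.prime_pow, padicValNat.prime_pow] at h3
        omega
      subst e
      have := Nat.eq_of_mul_eq_mul_right (pow_pos hp.pos i) h
      rw [this]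
    refine ⟨(K ×ˢ Finset.range M).image (fun x : ℕ × ℕ => x.1 * p ^ x.2), ?_, ?_, ?_⟩
    · rw [Finset.card_image_of_injOn hinj, Finset.card_product, hK1, Finset.card_range,
        Finset.card_insert_of_notMem hpS, pow_succ]
    · intro k hk
      obtain ⟨⟨k0, i⟩, hx, rfl⟩ := Finset.mem_image.mp hk
      rw [Finset.mem_product] at hx
      refine ⟨mul_ne_zero (hK2 k0 hx.1).1 (pow_ne_zero _ hp.ne_zero), fun q hq h => ?_⟩
      rcases (Nat.Prime.dvd_mul hq).mp h with h | h
      · exact Finset.mem_insert_of_mem ((hK2 k0 hx.1).2 q hq h)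
      · have := (Nat.prime_dvd_prime_iff_eq hq hp).mp (hq.dvd_of_dvd_pow h)
        rw [this]; exact Finset.mem_insert_self _ _
    · intro t
      rw [Finset.prod_insert hpS, hK3, Finset.sum_image hinj, Finset.sum_product, mul_comm, Finset.sum_mul_sum]
      refine Finset.sum_congr rfl fun k hk => Finset.sum_congr rfl fun j _ => ?_
      simp only
      rw [chi_mul d (hK2 k hk).1 (pow_ne_zero _ hp.ne_zero), en_mul (hK2 k hk).1 (pow_ne_zero _ hp.ne_zero),
        chi_pow d hp, en_pow hp.ne_zero, mul_pow]
      ring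


noncomputable def RS (S : Finset ℕ) (N : ℕ) (z : ℂ) : ℂ :=
  ∑ n ∈ (Finset.Icc 1 N).filter (fun n => ∀ p ∈ S, ¬ p ∣ n), (n:ℂ) ^ (-z)
noncomputable def ES (S : Finset ℕ) (z : ℂ) : ℂ := ∏ p ∈ S, (1 - (p:ℂ) ^ (-z))
noncomputable def FS (S : Finset ℕ) (N : ℕ) (z : ℂ) : ℂ := ES S z * riemannZeta z - RS S N z

lemma RS_insert {p : ℕ} {S : Finset ℕ} (hp : p.Prime) (hS : ∀ q ∈ S, q.Prime) (hpS : p ∉ S) (N : ℕ) (z : ℂ) :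
    RS (insert p S) N z = RS S N z - (p:ℂ) ^ (-z) * RS S (N / p) z := by
  rw [eq_sub_iff_add_eq]
  unfold RS
  have e : (p:ℂ) ^ (-z) * ∑ n ∈ (Finset.Icc 1 (N / p)).filter (fun n => ∀ p ∈ S, ¬ p ∣ n), (n:ℂ) ^ (-z)
      = ∑ n ∈ ((Finset.Icc 1 N).filter (fun n => ∀ p ∈ S, ¬ p ∣ n)).filter (fun n => p ∣ n), (n:ℂ) ^ (-z) := by
    rw [Finset.mul_sum]
    refine Finset.sum_bij (fun n _ => p * n) ?_ ?_ ?_ ?_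
    · intro n hn
      simp only [Finset.mem_filter, Finset.mem_Icc] at hn ⊢
      refine ⟨⟨⟨?_, ?_⟩, ?_⟩, dvd_mul_right _ _⟩
      · exact Nat.mul_pos hp.pos hn.1.1
      · have := (Nat.le_div_iff_mul_le hp.pos).mp hn.1.2
        rwa [mul_comm]
      · intro q hq h
        rcases (Nat.Prime.dvd_mul (hS q hq)).mp h with h | h
        · exact hpS ((Nat.prime_dvd_prime_iff_eq (hS q hq) hp).mp h ▸ hq)
        · exact hn.2 q hq h
    · intro a _ b _ h
      exact Nat.eq_of_mul_eq_mul_left hp.pos h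
    · intro n hn
      simp only [Finset.mem_filter, Finset.mem_Icc] at hn
      obtain ⟨⟨⟨h1, h2⟩, h3⟩, ⟨m, rfl⟩⟩ := hn
      refine ⟨m, ?_, rfl⟩
      simp only [Finset.mem_filter, Finset.mem_Icc]
      refine ⟨⟨Nat.pos_of_ne_zero (by rintro rfl; simp at h1), ?_⟩, ?_⟩
      · rw [Nat.le_div_iff_mul_le hp.pos, mul_comm]; exact h2
      · intro q hq h
        exact h3 q hq (Dvd.dvd.mul_left h p)
    · intro n _
      rw [Nat.cast_mul, Complex.natCast_mul_natCast_cpow]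
  rw [e, ← Finset.sum_filter_add_sum_filter_not ((Finset.Icc 1 N).filter (fun n => ∀ p ∈ S, ¬ p ∣ n)) (fun n => p ∣ n), add_comm]
  congr 1
  refine Finset.sum_congr ?_ fun _ _ => rfl
  ext n
  simp only [Finset.mem_filter, Finset.mem_insert, forall_eq_or_imp]
  tauto

lemma cpow_neg_cont {p : ℕ} (hp : p ≠ 0) : Continuous (fun z : ℂ => (p:ℂ) ^ (-z)) :=
  Continuous.const_cpow continuous_neg (Or.inl (by exact_mod_cast hp))

lemma RS_cont (S : Finset ℕ) (N : ℕ) : Continuous (RS S N) := by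
  unfold RS
  refine continuous_finsetSum _ fun n hn => ?_
  rw [Finset.mem_filter, Finset.mem_Icc] at hn
  exact cpow_neg_cont (by omega)

lemma ES_cont {S : Finset ℕ} (hS : ∀ q ∈ S, q.Prime) : Continuous (ES S) := by
  unfold ES
  refine continuous_finsetProd _ fun n hn => continuous_const.sub (cpow_neg_cont (hS n hn).ne_zero)

lemma zeta_comp_cont {X : Type*} [TopologicalSpace X] {g : X → ℂ} (hg : Continuous g) (h : ∀ x, (g x).re ≠ 1) :
    Continuous (fun x => riemannZeta (g x)) := by
  rw [continuous_iff_continuousAt]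
  intro t
  have hne : g t ≠ 1 := by
    intro h'
    exact h t (by rw [h']; simp)
  exact ContinuousAt.comp (f := g) (differentiableAt_riemannZeta hne).continuousAt hg.continuousAt

lemma FS_comp_cont {S : Finset ℕ} (hS : ∀ q ∈ S, q.Prime) (N : ℕ) {X : Type*} [TopologicalSpace X] {g : X → ℂ}
    (hg : Continuous g) (h : ∀ x, (g x).re ≠ 1) : Continuous (fun x => FS S N (g x)) := by
  unfold FS
  exact (((ES_cont hS).comp hg).mul (zeta_comp_cont hg h)).sub ((RS_cont S N).comp hg)

theorem meansq_S {σ₁ σ₂ : ℝ} (hσ₁ : 1 / 2 < σ₁) (hσ₂ : σ₂ < 1) (S : Finset ℕ) (hS : ∀ q ∈ S, q.Prime) :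
    ∀ ε : ℝ, 0 < ε →
    ∃ N0 : ℕ, ∀ N ≥ N0, ∃ T0 : ℝ, ∀ T ≥ T0, ∀ σ : ℝ, σ₁ ≤ σ → σ ≤ σ₂ →
      ∫ t in (T - 1)..(2 * T + 1), ‖FS S N (σ + t * I)‖ ^ 2 ≤ ε * T := by
  induction S using Finset.induction_on with
  | empty =>
    intro ε hε
    have : ∀ N z, FS ∅ N z = riemannZeta z - zN N z := by
      intro N z; simp [FS, ES, RS, zN]
    simp_rw [this]
    exact meansq hσ₁ hσ₂ hε
  | insert p S hpS ih =>
    intro ε hε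
    have hp : p.Prime := hS p (Finset.mem_insert_self _ _)
    have hS' : ∀ q ∈ S, q.Prime := fun q hq => hS q (Finset.mem_insert_of_mem hq)
    obtain ⟨N0, hN0⟩ := ih hS' (ε / 4) (by linarith)
    refine ⟨N0 * p, fun N hN => ?_⟩
    have hp1 := hp.one_lt
    obtain ⟨T1, hT1⟩ := hN0 N (by nlinarith)
    obtain ⟨T2, hT2⟩ := hN0 (N / p) ((Nat.le_div_iff_mul_le hp.pos).mpr hN)
    refine ⟨max (max T1 T2) 0, fun T hT σ h1 h2 => ?_⟩
    have b1 := hT1 T (le_trans (le_trans (le_max_left _ _) (le_max_left _ _)) hT) σ h1 h2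
    have b2 := hT2 T (le_trans (le_trans (le_max_right _ _) (le_max_left _ _)) hT) σ h1 h2
    have hT0 : 0 ≤ T := le_trans (le_max_right _ _) hT
    have hc : ∀ (S : Finset ℕ) (N : ℕ), (∀ q ∈ S, q.Prime) → Continuous (fun t : ℝ => ‖FS S N (σ + t * I)‖ ^ 2) := by
      intro S N h
      refine (FS_comp_cont h N (by fun_prop) ?_).norm.pow 2
      intro t
      simp
      linarith
    have hpt : ∀ t : ℝ, ‖FS (insert p S) N (σ + t * I)‖ ^ 2 ≤ 2 * ‖FS S N (σ + t * I)‖ ^ 2 + 2 * ‖FS S (N / p) (σ + t * I)‖ ^ 2 := by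
      intro t
      set z : ℂ := σ + t * I with hz
      have e : FS (insert p S) N z = FS S N z - (p:ℂ) ^ (-z) * FS S (N / p) z := by
        unfold FS
        rw [RS_insert hp hS' hpS]
        unfold ES
        rw [Finset.prod_insert hpS]; ring
      have hn : ‖(p:ℂ) ^ (-z)‖ ≤ 1 := by
        rw [Complex.norm_natCast_cpow_of_pos hp.pos]
        apply Real.rpow_le_one_of_one_le_of_nonpos (by exact_mod_cast hp.one_lt.le)
        simp [hz]; linarith
      have : ‖FS (insert p S) N z‖ ≤ ‖FS S N z‖ + ‖FS S (N / p) z‖ := by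
        rw [e]
        refine (norm_sub_le _ _).trans (add_le_add le_rfl ?_)
        rw [norm_mul]
        exact mul_le_of_le_one_left (norm_nonneg _) hn
      have h0 := norm_nonneg (FS (insert p S) N z)
      nlinarith [sq_nonneg (‖FS S N z‖ - ‖FS S (N / p) z‖), norm_nonneg (FS S N z), norm_nonneg (FS S (N/p) z)]
    calc ∫ t in (T - 1)..(2 * T + 1), ‖FS (insert p S) N (σ + t * I)‖ ^ 2
        ≤ ∫ t in (T - 1)..(2 * T + 1), (2 * ‖FS S N (σ + t * I)‖ ^ 2 + 2 * ‖FS S (N / p) (σ + t * I)‖ ^ 2) := by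
          apply intervalIntegral.integral_mono_on (by linarith)
          · exact (hc _ _ hS).intervalIntegrable _ _
          · exact (((hc _ _ hS').const_mul _).add ((hc _ _ hS').const_mul _)).intervalIntegrable _ _
          · intro t _; exact hpt t
      _ = 2 * (∫ t in (T - 1)..(2 * T + 1), ‖FS S N (σ + t * I)‖ ^ 2) + 2 * ∫ t in (T - 1)..(2 * T + 1), ‖FS S (N / p) (σ + t * I)‖ ^ 2 := by
          rw [intervalIntegral.integral_add, intervalIntegral.integral_const_mul, intervalIntegral.integral_const_mul]
          · exact ((hc _ _ hS').const_mul _).intervalIntegrable _ _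
          · exact ((hc _ _ hS').const_mul _).intervalIntegrable _ _
      _ ≤ ε * T := by linarith


noncomputable def QQ (S : Finset ℕ) (M : ℕ) (d : ℕ → ℂ) (t : ℝ) : ℂ :=
  ∏ p ∈ S, ∑ j ∈ Finset.range M, (d p * en p t) ^ j

lemma QQ_cont (S : Finset ℕ) (M : ℕ) (d : ℕ → ℂ) : Continuous (QQ S M d) := by
  unfold QQ
  refine continuous_finsetProd _ fun p _ => continuous_finsetSum _ fun j _ => ?_
  exact ((continuous_const.mul (en_cont p)).pow j)

lemma QQ_norm_le (S : Finset ℕ) (M : ℕ) {d : ℕ → ℂ} (hd : ∀ p, ‖d p‖ = 1) (t : ℝ) :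
    ‖QQ S M d t‖ ≤ (M:ℝ) ^ S.card := by
  unfold QQ
  rw [norm_prod]
  refine (Finset.prod_le_prod (fun _ _ => norm_nonneg _) (g := fun _ => (M:ℝ)) fun p _ => ?_).trans (by simp)
  refine (norm_sum_le _ _).trans ?_
  simp [hd, en_norm]

lemma log_injOn_nat {K : Finset ℕ} (hK : ∀ k ∈ K, k ≠ 0) : Set.InjOn (fun k : ℕ => Real.log k) K := by
  intro a ha b hb h
  have h1 : (0:ℝ) < a := by exact_mod_cast Nat.pos_of_ne_zero (hK a ha)
  have h2 : (0:ℝ) < b := by exact_mod_cast Nat.pos_of_ne_zero (hK b hb)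
  exact_mod_cast Real.log_injOn_pos h1 h2 h

lemma QQ_mean {S : Finset ℕ} (hS : ∀ p ∈ S, p.Prime) (M : ℕ) {d : ℕ → ℂ} (hd : ∀ p, ‖d p‖ = 1) :
    ∃ C : ℝ, ∀ T : ℝ, |(∫ t in T..(2 * T), ‖QQ S M d t‖ ^ 2) - T * (M:ℝ) ^ S.card| ≤ C := by
  obtain ⟨K, hK1, hK2, hK3⟩ := Q_expand d M S hS
  obtain ⟨C, hC⟩ := dp_mean K (fun k : ℕ => Real.log k) (log_injOn_nat fun k hk => (hK2 k hk).1)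
  refine ⟨C, fun T => ?_⟩
  have := hC (chi d) (fun k _ => (chi_norm hd k).le) T
  simp only [chi_norm hd, one_pow, Finset.sum_const, nsmul_eq_mul, mul_one, hK1] at this
  push_cast at this ⊢
  unfold QQ
  simp_rw [hK3]
  unfold en
  push_cast
  exact this

lemma QQ_erase {S : Finset ℕ} (M : ℕ) {d : ℕ → ℂ} (hd : ∀ p, ‖d p‖ = 1) {p : ℕ} (hp : p ∈ S) (t : ℝ) :
    ‖QQ S M d t‖ ^ 2 * ‖1 - d p * en p t‖ ^ 2 ≤ 4 * ‖QQ (S.erase p) M d t‖ ^ 2 := by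
  rw [← mul_pow, ← norm_mul]
  have e : QQ S M d t * (1 - d p * en p t) = (1 - (d p * en p t) ^ M) * QQ (S.erase p) M d t := by
    unfold QQ
    rw [← Finset.mul_prod_erase S _ hp, ← geom_sum_mul_neg]
    ring
  rw [e, norm_mul, mul_pow]
  have : ‖1 - (d p * en p t) ^ M‖ ≤ 2 := by
    refine (norm_sub_le _ _).trans ?_
    rw [norm_pow, norm_mul, hd, en_norm]; norm_num
  have h0 := norm_nonneg (1 - (d p * en p t) ^ M)
  have : ‖1 - (d p * en p t) ^ M‖ ^ 2 ≤ 4 := by nlinarith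
  gcongr

lemma QQ_RS {S : Finset ℕ} (hS : ∀ p ∈ S, p.Prime) (M : ℕ) {d : ℕ → ℂ} (hd : ∀ p, ‖d p‖ = 1)
    {y : ℕ} (hy : ∀ p : ℕ, p.Prime → p ≤ y → p ∈ S) {N : ℕ} (hN : 1 ≤ N) {σ₁ : ℝ} (hσ : 0 < σ₁) :
    ∃ C : ℝ, ∀ z : ℂ, σ₁ ≤ z.re → ∀ T : ℝ, 0 ≤ T →
      ∫ t in T..(2 * T), ‖QQ S M d t * (RS S N (z + t * I) - 1)‖ ^ 2 ≤
        T * ((M:ℝ) ^ S.card * ∑ n ∈ Finset.Ioc y N, (n:ℝ) ^ (-(2 * σ₁))) + C := by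
  obtain ⟨K, hK1, hK2, hK3⟩ := Q_expand d M S hS
  set A : Finset ℕ := (Finset.Icc 2 N).filter (fun n => ∀ p ∈ S, ¬ p ∣ n) with hA
  have hAm : ∀ n ∈ A, 2 ≤ n ∧ n ≤ N ∧ ∀ p ∈ S, ¬ p ∣ n := by
    intro n hn
    rw [hA, Finset.mem_filter, Finset.mem_Icc] at hn
    exact ⟨hn.1.1, hn.1.2, hn.2⟩
  have hAy : A ⊆ Finset.Ioc y N := by
    intro n hn
    obtain ⟨h1, h2, h3⟩ := hAm n hn
    rw [Finset.mem_Ioc]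
    refine ⟨?_, h2⟩
    by_contra hlt
    have hmp := Nat.minFac_prime (n := n) (by omega)
    exact h3 n.minFac (hy _ hmp ((Nat.minFac_le (by omega)).trans (by omega))) (Nat.minFac_dvd n)
  have hR : ∀ w : ℂ, RS S N w - 1 = ∑ n ∈ A, (n:ℂ) ^ (-w) := by
    intro w
    have : (Finset.Icc 1 N).filter (fun n => ∀ p ∈ S, ¬ p ∣ n) = insert 1 A := by
      ext n
      rw [hA]
      simp only [Finset.mem_insert, Finset.mem_filter, Finset.mem_Icc]
      constructor
      · rintro ⟨⟨h1, h2⟩, h3⟩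
        by_cases h : n = 1
        · exact Or.inl h
        · exact Or.inr ⟨⟨by omega, h2⟩, h3⟩
      · rintro (h | ⟨⟨h1, h2⟩, h3⟩)
        · subst h
          refine ⟨⟨le_rfl, hN⟩, fun p hp h => ?_⟩
          exact (hS p hp).one_lt.ne' (Nat.dvd_one.mp h)
        · exact ⟨⟨by omega, h2⟩, h3⟩
    unfold RS
    rw [this, Finset.sum_insert (by intro h; have := (hAm 1 h).1; omega)]
    simp
  have hcop : ∀ k ∈ K, ∀ n ∈ A, Nat.Coprime k n := by
    intro k hk n hn
    apply Nat.coprime_of_dvd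
    intro q hq h1 h2
    exact (hAm n hn).2.2 q ((hK2 k hk).2 q hq h1) h2
  have hinj : Set.InjOn (fun x : ℕ × ℕ => Real.log ((x.1 * x.2 : ℕ) : ℝ)) ((K ×ˢ A : Finset (ℕ × ℕ)) : Set (ℕ × ℕ)) := by
    rintro ⟨k, n⟩ h1 ⟨k', n'⟩ h2 h
    simp only [Finset.coe_product, Set.mem_prod, Finset.mem_coe] at h1 h2
    simp only at h
    have hn := (hAm n h1.2).1
    have hn' := (hAm n' h2.2).1
    have hk := Nat.pos_of_ne_zero (hK2 k h1.1).1
    have hk' := Nat.pos_of_ne_zero (hK2 k' h2.1).1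
    have h3 : k * n = k' * n' := by
      have a1 : (0:ℝ) < ((k * n : ℕ) : ℝ) := by exact_mod_cast Nat.mul_pos hk (by omega)
      have a2 : (0:ℝ) < ((k' * n' : ℕ) : ℝ) := by exact_mod_cast Nat.mul_pos hk' (by omega)
      exact_mod_cast Real.log_injOn_pos a1 a2 h
    have d1 : k ∣ k' := (hcop k h1.1 n' h2.2).dvd_of_dvd_mul_right (h3 ▸ dvd_mul_right k n)
    have d2 : k' ∣ k := (hcop k' h2.1 n h1.2).dvd_of_dvd_mul_right (h3 ▸ dvd_mul_right k' n')
    have e := Nat.dvd_antisymm d1 d2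
    subst e
    rw [Nat.eq_of_mul_eq_mul_left hk h3]
  obtain ⟨C, hC⟩ := dp_mean (K ×ˢ A) _ hinj
  refine ⟨C, fun z hz T hT => ?_⟩
  have hnorm : ∀ n ∈ A, ‖(n:ℂ) ^ (-z)‖ ≤ 1 ∧ ‖(n:ℂ) ^ (-z)‖ ^ 2 ≤ (n:ℝ) ^ (-(2 * σ₁)) := by
    intro n hn
    have h1 := (hAm n hn).1
    have h2 : (1:ℝ) ≤ n := by exact_mod_cast (by omega : 1 ≤ n)
    rw [Complex.norm_natCast_cpow_of_pos (by omega), neg_re]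
    refine ⟨Real.rpow_le_one_of_one_le_of_nonpos h2 (by linarith), ?_⟩
    rw [← Real.rpow_natCast, ← Real.rpow_mul (by linarith)]
    apply Real.rpow_le_rpow_of_exponent_le h2
    push_cast; linarith
  have hCb := hC (fun x => chi d x.1 * (x.2:ℂ) ^ (-z)) (by
    rintro ⟨k, n⟩ hx
    rw [Finset.mem_product] at hx
    simp only [norm_mul, chi_norm hd, one_mul]
    exact (hnorm n hx.2).1) T
  have e : ∀ t : ℝ, QQ S M d t * (RS S N (z + t * I) - 1) = ∑ x ∈ K ×ˢ A, (chi d x.1 * (x.2:ℂ) ^ (-z)) *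
      cexp (((-(Real.log ((x.1 * x.2 : ℕ) : ℝ)) * t : ℝ) : ℂ) * I) := by
    intro t
    rw [hR, QQ, hK3, Finset.sum_mul_sum, Finset.sum_product]
    refine Finset.sum_congr rfl fun k hk => Finset.sum_congr rfl fun n hn => ?_
    have hn0 : n ≠ 0 := by have := (hAm n hn).1; omega
    rw [cpow_en hn0]
    have := en_mul (hK2 k hk).1 hn0 t
    simp only
    rw [show cexp (((-(Real.log ((k * n : ℕ) : ℝ)) * t : ℝ) : ℂ) * I) = en (k * n) t from rfl, this]
    ring
  simp_rw [e]
  have h5 := (abs_le.mp hCb).2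
  have h6 : ∑ x ∈ K ×ˢ A, ‖chi d x.1 * (x.2:ℂ) ^ (-z)‖ ^ 2 ≤ (M:ℝ) ^ S.card * ∑ n ∈ Finset.Ioc y N, (n:ℝ) ^ (-(2 * σ₁)) := by
    rw [Finset.sum_product]
    simp only [norm_mul, chi_norm hd, one_mul, Finset.sum_const, nsmul_eq_mul, hK1]
    push_cast
    refine mul_le_mul_of_nonneg_left ?_ (by positivity)
    refine (Finset.sum_le_sum fun n hn => (hnorm n hn).2).trans ?_
    exact Finset.sum_le_sum_of_subset_of_nonneg hAy (fun n _ _ => by positivity)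
  have h7 := mul_le_mul_of_nonneg_left h6 hT
  linarith

lemma swap_int {h : ℝ → ℝ → ℝ} (hc : Continuous (Function.uncurry h)) {a b c d : ℝ} (hab : a ≤ b) (hcd : c ≤ d) :
    ∫ t in a..b, ∫ θ in c..d, h t θ = ∫ θ in c..d, ∫ t in a..b, h t θ := by
  simp_rw [intervalIntegral.integral_of_le hab, intervalIntegral.integral_of_le hcd]
  apply MeasureTheory.integral_integral_swap
  rw [Measure.prod_restrict]
  have : IntegrableOn (Function.uncurry h) (Icc a b ×ˢ Icc c d) (volume.prod volume) :=
    hc.continuousOn.integrableOn_compact (isCompact_Icc.prod isCompact_Icc)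
  exact this.mono_set (Set.prod_mono Ioc_subset_Icc_self Ioc_subset_Icc_self)


lemma circle_re_bd {σ0 r : ℝ} (hr : 0 < r) (θ t : ℝ) :
    σ0 - r ≤ (circleMap σ0 r θ + t * I).re ∧ (circleMap σ0 r θ + t * I).re ≤ σ0 + r := by
  have : (circleMap σ0 r θ + t * I).re = σ0 + r * Real.cos θ := by
    simp [circleMap, Complex.exp_ofReal_mul_I_re]
  rw [this]
  have h1 := Real.neg_one_le_cos θ
  have h2 := Real.cos_le_one θ
  constructor <;> nlinarith

lemma FS_circle {σ0 r : ℝ} (hr : 0 < r) (hr1 : r ≤ 1) (h2 : σ0 + r < 1)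
    {S : Finset ℕ} (hS : ∀ q ∈ S, q.Prime) (N : ℕ) {T B : ℝ} (hT : 0 ≤ T)
    (hB : ∀ σ : ℝ, σ0 - r ≤ σ → σ ≤ σ0 + r → ∫ t in (T - 1)..(2 * T + 1), ‖FS S N (σ + t * I)‖ ^ 2 ≤ B) (θ : ℝ) :
    ∫ t in T..(2 * T), ‖FS S N (circleMap σ0 r θ + t * I)‖ ^ 2 ≤ B := by
  have c1 := Real.neg_one_le_cos θ
  have c2 := Real.cos_le_one θ
  have s1 := Real.neg_one_le_sin θ
  have s2 := Real.sin_le_one θ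
  set σ := σ0 + r * Real.cos θ with hσ
  set g : ℝ → ℝ := fun t => ‖FS S N (σ + t * I)‖ ^ 2 with hg
  have e : ∀ t : ℝ, ‖FS S N (circleMap σ0 r θ + t * I)‖ ^ 2 = g (t + r * Real.sin θ) := by
    intro t
    simp only [hg]
    congr 3
    rw [circleMap, Complex.exp_mul_I, ← ofReal_cos, ← ofReal_sin, hσ]
    push_cast; ring
  simp_rw [e]
  rw [intervalIntegral.integral_comp_add_right]
  refine le_trans ?_ (hB σ (by nlinarith) (by nlinarith))
  have hc : Continuous g := by
    refine (FS_comp_cont hS N (by fun_prop) ?_).norm.pow 2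
    intro t
    simp
    nlinarith
  apply intervalIntegral.integral_mono_interval
  · nlinarith
  · linarith
  · nlinarith
  · exact Eventually.of_forall fun t => by simp only [hg]; positivity
  · exact hc.intervalIntegrable _ _

lemma cont_left {f : ℝ → ℝ → ℝ} (hfc : Continuous (Function.uncurry f)) (θ : ℝ) : Continuous (fun t => f t θ) := by
  have h : Continuous (fun t : ℝ => (t, θ)) := by fun_prop
  exact hfc.comp h

lemma swap_int_le {h : ℝ → ℝ → ℝ} (hc : Continuous (Function.uncurry h)) {a b c d B : ℝ} (hab : a ≤ b) (hcd : c ≤ d)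
    (hB : ∀ θ, ∫ t in a..b, h t θ ≤ B) : ∫ t in a..b, ∫ θ in c..d, h t θ ≤ (d - c) * B := by
  rw [swap_int hc hab hcd]
  have hcont : Continuous (fun θ => ∫ t in a..b, h t θ) := by
    apply intervalIntegral.continuous_parametric_intervalIntegral_of_continuous'
    exact hc.comp continuous_swap
  refine (intervalIntegral.integral_mono_on hcd (hcont.intervalIntegrable _ _) intervalIntegrable_const
    (fun θ _ => hB θ)).trans ?_
  rw [intervalIntegral.integral_const, smul_eq_mul]

lemma norm_add_sq_le2 (a b : ℂ) : ‖a + b‖ ^ 2 ≤ 2 * ‖a‖ ^ 2 + 2 * ‖b‖ ^ 2 := by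
  have n1 := norm_add_le a b
  have n2 := norm_nonneg (a + b)
  nlinarith [sq_nonneg (‖a‖ - ‖b‖), norm_nonneg a, norm_nonneg b]

set_option maxHeartbeats 1000000 in
theorem core {σ0 r : ℝ} (hr : 0 < r) (hr1 : r ≤ 1) (h1 : 1 / 2 < σ0 - r) (h2 : σ0 + r < 1) {κ : ℝ} (hκ : 0 < κ) :
    ∃ y0 : ℕ, ∀ S : Finset ℕ, (∀ p ∈ S, p.Prime) → (∀ p : ℕ, p.Prime → p ≤ y0 → p ∈ S) →
      ∀ c : ℕ → ℂ, (∀ p, ‖c p‖ = 1) → ∀ κ' > 0, ∀ T0 : ℝ, ∃ t ≥ T0,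
        (∫ θ in (0:ℝ)..(2 * Real.pi), ‖ES S (circleMap σ0 r θ + t * I) * riemannZeta (circleMap σ0 r θ + t * I) - 1‖ ^ 2) ≤ κ
        ∧ ∀ p ∈ S, ‖en p t - c p‖ ≤ κ' := by
  have hpi := Real.pi_pos
  set σ₁ := σ0 - r with hσ₁
  have hsum : Summable (fun n : ℕ => (n:ℝ) ^ (-(2 * σ₁))) := Real.summable_nat_rpow.mpr (by linarith)
  set τ : ℝ := κ / (16 * Real.pi) with hτ
  obtain ⟨s, hs⟩ := (summable_iff_vanishing_norm.mp hsum) τ (by positivity)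
  refine ⟨s.sup id, fun S hS hSy c hc κ' hκ' T0 => ?_⟩
  have htail : ∀ M : ℕ, ∑ n ∈ Finset.Ioc (s.sup id) M, (n:ℝ) ^ (-(2 * σ₁)) ≤ τ := by
    intro M
    refine (le_abs_self _).trans (hs _ ?_).le
    rw [Finset.disjoint_left]
    intro n hn hns
    have h1 := (Finset.mem_Ioc.mp hn).1
    have h2 : n ≤ s.sup id := Finset.le_sup (f := id) hns
    omega
  set d : ℕ → ℂ := fun p => (starRingEnd ℂ) (c p) with hd'
  have hd : ∀ p, ‖d p‖ = 1 := fun p => by rw [hd', Complex.norm_conj, hc]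
  have hdc : ∀ p t, ‖1 - d p * en p t‖ = ‖en p t - c p‖ := by
    intro p t
    have : c p * (1 - d p * en p t) = c p - en p t := by
      have : c p * d p = 1 := by
        rw [hd', Complex.mul_conj', hc]; simp
      rw [mul_sub, ← mul_assoc, this]; ring
    rw [norm_sub_rev (en p t), ← this, norm_mul, hc, one_mul]
  obtain ⟨M, hM⟩ := exists_nat_gt (16 * S.card / κ' ^ 2)
  have hM0 : (0:ℝ) < M := lt_of_le_of_lt (by positivity) hM
  set X : ℝ := (M:ℝ) ^ S.card with hX
  have hX0 : 0 < X := by positivity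
  set ε : ℝ := κ / (16 * Real.pi * X) with hε
  obtain ⟨N0, hN0⟩ := meansq_S h1 h2 S hS ε (by positivity)
  set N := max N0 1
  obtain ⟨T1, hT1⟩ := hN0 N (le_max_left _ _)
  obtain ⟨C1, hC1⟩ := QQ_mean hS M hd
  obtain ⟨C2, hC2⟩ := QQ_RS hS M hd hSy (le_max_right N0 1) (show 0 < σ₁ by linarith)
  have h3 : ∀ p, ∃ C : ℝ, ∀ T : ℝ, |(∫ t in T..(2 * T), ‖QQ (S.erase p) M d t‖ ^ 2) - T * (M:ℝ) ^ (S.erase p).card| ≤ C :=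
    fun p => QQ_mean (fun q hq => hS q (Finset.mem_of_mem_erase hq)) M hd
  choose C3 hC3 using h3
  set CT : ℝ := C1 + 4 * Real.pi * C2 / κ + ∑ p ∈ S, 4 / κ' ^ 2 * C3 p with hCT
  set T : ℝ := max (max T0 T1) (max 0 (4 * CT / X + 1)) with hT
  have hTa : T0 ≤ T := le_trans (le_max_left _ _) (le_max_left _ _)
  have hTb : T1 ≤ T := le_trans (le_max_right _ _) (le_max_left _ _)
  have hTc : 0 ≤ T := le_trans (le_max_left _ _) (le_max_right _ _)
  have hTd : 4 * CT / X + 1 ≤ T := le_trans (le_max_right _ _) (le_max_right _ _)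
  by_contra hcon
  push Not at hcon
  set f : ℝ → ℝ → ℝ := fun t θ => ‖ES S (circleMap σ0 r θ + t * I) * riemannZeta (circleMap σ0 r θ + t * I) - 1‖ ^ 2 with hf
  have hcirc : Continuous (fun x : ℝ × ℝ => circleMap σ0 r x.2 + x.1 * I) := by
    have := (continuous_circleMap σ0 r).comp (continuous_snd (X := ℝ) (Y := ℝ))
    exact this.add (by fun_prop)
  have hfc : Continuous (Function.uncurry f) := by
    refine ((((ES_cont hS).comp hcirc).mul (zeta_comp_cont hcirc ?_)).sub continuous_const).norm.pow 2
    intro x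
    have := (circle_re_bd (σ0 := σ0) hr x.2 x.1).2
    linarith
  have hfcomp : ∀ θ : ℝ, Continuous (fun t => f t θ) := fun θ => cont_left hfc θ
  set J : ℝ → ℝ := fun t => ∫ θ in (0:ℝ)..(2 * Real.pi), f t θ with hJ
  have hJc : Continuous J := intervalIntegral.continuous_parametric_intervalIntegral_of_continuous' hfc _ _
  have hJ0 : ∀ t, 0 ≤ J t := fun t => intervalIntegral.integral_nonneg (by positivity) fun θ _ => by simp only [hf]; positivity
  have hle : T ≤ 2 * T := by linarith
  have hQc := QQ_cont S M d
  -- pointwise lower bound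
  have hpt : ∀ t ∈ Icc T (2 * T), ‖QQ S M d t‖ ^ 2 ≤
      1 / κ * (‖QQ S M d t‖ ^ 2 * J t) + ∑ p ∈ S, 4 / κ' ^ 2 * ‖QQ (S.erase p) M d t‖ ^ 2 := by
    intro t ht
    have hq0 : 0 ≤ ‖QQ S M d t‖ ^ 2 := by positivity
    have hs0 : ∀ p ∈ S, 0 ≤ 4 / κ' ^ 2 * ‖QQ (S.erase p) M d t‖ ^ 2 := fun p _ => by positivity
    by_cases hJt : J t ≤ κ
    · obtain ⟨p, hp, hlt⟩ := hcon t (hTa.trans ht.1) hJt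
      have h5 := QQ_erase M hd hp t
      rw [hdc] at h5
      have h6 : ‖QQ S M d t‖ ^ 2 ≤ 4 / κ' ^ 2 * ‖QQ (S.erase p) M d t‖ ^ 2 := by
        rw [div_mul_eq_mul_div, le_div_iff₀ (by positivity)]
        refine le_trans ?_ h5
        gcongr
      have h7 := Finset.single_le_sum hs0 hp
      have h8 : 0 ≤ 1 / κ * (‖QQ S M d t‖ ^ 2 * J t) := by have := hJ0 t; positivity
      linarith
    · push Not at hJt
      have h8 : ‖QQ S M d t‖ ^ 2 ≤ 1 / κ * (‖QQ S M d t‖ ^ 2 * J t) := by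
        rw [one_div_mul_eq_div, le_div_iff₀ hκ]
        gcongr
      have := Finset.sum_nonneg hs0
      linarith
  have hintg : ∫ t in T..(2 * T), ‖QQ S M d t‖ ^ 2 ≤
      1 / κ * (∫ t in T..(2 * T), ‖QQ S M d t‖ ^ 2 * J t) +
        ∑ p ∈ S, 4 / κ' ^ 2 * ∫ t in T..(2 * T), ‖QQ (S.erase p) M d t‖ ^ 2 := by
    have i1 : IntervalIntegrable (fun t => 1 / κ * (‖QQ S M d t‖ ^ 2 * J t)) volume T (2 * T) :=
      (((hQc.norm.pow 2).mul hJc).const_mul _).intervalIntegrable _ _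
    have i2 : ∀ p ∈ S, IntervalIntegrable (fun t => 4 / κ' ^ 2 * ‖QQ (S.erase p) M d t‖ ^ 2) volume T (2 * T) :=
      fun p _ => (((QQ_cont (S.erase p) M d).norm.pow 2).const_mul _).intervalIntegrable _ _
    have i3 : IntervalIntegrable (fun t => ∑ p ∈ S, 4 / κ' ^ 2 * ‖QQ (S.erase p) M d t‖ ^ 2) volume T (2 * T) := by
      apply Continuous.intervalIntegrable
      exact continuous_finsetSum _ fun p _ => (((QQ_cont (S.erase p) M d).norm.pow 2).const_mul _)
    refine (intervalIntegral.integral_mono_on hle ((hQc.norm.pow 2).intervalIntegrable _ _) (i1.add i3) hpt).trans ?_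
    rw [intervalIntegral.integral_add i1 i3, intervalIntegral.integral_const_mul, intervalIntegral.integral_finsetSum i2]
    simp_rw [intervalIntegral.integral_const_mul]
    exact le_rfl
  -- J part
  have hJint : ∫ t in T..(2 * T), ‖QQ S M d t‖ ^ 2 * J t ≤
      2 * Real.pi * (2 * X ^ 2 * (ε * T) + 2 * (T * (X * τ) + C2)) := by
    have e1 : ∀ t, ‖QQ S M d t‖ ^ 2 * J t = ∫ θ in (0:ℝ)..(2 * Real.pi), ‖QQ S M d t‖ ^ 2 * f t θ := by
      intro t
      rw [intervalIntegral.integral_const_mul]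
    have hcc : Continuous (Function.uncurry (fun t θ => ‖QQ S M d t‖ ^ 2 * f t θ)) :=
      ((hQc.comp continuous_fst).norm.pow 2).mul hfc
    simp_rw [e1]
    have hb : ∀ θ, ∫ t in T..(2 * T), ‖QQ S M d t‖ ^ 2 * f t θ ≤ 2 * X ^ 2 * (ε * T) + 2 * (T * (X * τ) + C2) := by
      intro θ
      set z := circleMap σ0 r θ with hz
      have hzt : Continuous (fun t : ℝ => z + t * I) := by fun_prop
      have hre : ∀ t : ℝ, (z + t * I).re ≠ 1 := by
        intro t
        have := (circle_re_bd (σ0 := σ0) hr θ t).2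
        rw [← hz] at this
        linarith
      have k1 : Continuous (fun t : ℝ => 2 * X ^ 2 * ‖FS S N (z + t * I)‖ ^ 2) :=
        ((FS_comp_cont hS N hzt hre).norm.pow 2).const_mul _
      have k2 : Continuous (fun t : ℝ => 2 * ‖QQ S M d t * (RS S N (z + t * I) - 1)‖ ^ 2) :=
        ((hQc.mul (((RS_cont S N).comp hzt).sub continuous_const)).norm.pow 2).const_mul _
      have hf1 : Continuous (fun t => f t θ) := hfcomp θ
      have k3 : Continuous (fun t => ‖QQ S M d t‖ ^ 2 * f t θ) :=
        (hQc.norm.pow 2).mul hf1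
      calc ∫ t in T..(2 * T), ‖QQ S M d t‖ ^ 2 * f t θ
          ≤ ∫ t in T..(2 * T), (2 * X ^ 2 * ‖FS S N (z + t * I)‖ ^ 2 + 2 * ‖QQ S M d t * (RS S N (z + t * I) - 1)‖ ^ 2) := by
            apply intervalIntegral.integral_mono_on hle (k3.intervalIntegrable _ _) ((k1.add k2).intervalIntegrable _ _)
            intro t _
            have e2 : ES S (z + t * I) * riemannZeta (z + t * I) - 1 = FS S N (z + t * I) + (RS S N (z + t * I) - 1) := by
              unfold FS; ring
            have e3 : f t θ ≤ 2 * ‖FS S N (z + t * I)‖ ^ 2 + 2 * ‖RS S N (z + t * I) - 1‖ ^ 2 := by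
              simp only [hf]
              rw [← hz, e2]
              exact norm_add_sq_le2 _ _
            have e4 : ‖QQ S M d t‖ ^ 2 ≤ X ^ 2 := by
              gcongr
              exact QQ_norm_le S M hd t
            change _ ≤ 2 * X ^ 2 * ‖FS S N (z + t * I)‖ ^ 2 + 2 * ‖QQ S M d t * (RS S N (z + t * I) - 1)‖ ^ 2
            rw [norm_mul, mul_pow]
            have q0 : 0 ≤ ‖QQ S M d t‖ ^ 2 := by positivity
            have f0 : 0 ≤ ‖FS S N (z + t * I)‖ ^ 2 := by positivity
            have m1 := mul_le_mul_of_nonneg_left e3 q0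
            have m2 := mul_le_mul_of_nonneg_right e4 f0
            generalize ‖QQ S M d t‖ ^ 2 = q at *
            generalize ‖FS S N (z + t * I)‖ ^ 2 = u at *
            generalize ‖RS S N (z + t * I) - 1‖ ^ 2 = v at *
            generalize f t θ = w at *
            linarith
        _ = 2 * X ^ 2 * (∫ t in T..(2 * T), ‖FS S N (z + t * I)‖ ^ 2) + 2 * ∫ t in T..(2 * T), ‖QQ S M d t * (RS S N (z + t * I) - 1)‖ ^ 2 := by
            rw [intervalIntegral.integral_add (k1.intervalIntegrable _ _) (k2.intervalIntegrable _ _),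
              intervalIntegral.integral_const_mul, intervalIntegral.integral_const_mul]
        _ ≤ _ := by
            refine add_le_add (mul_le_mul_of_nonneg_left ?_ (by positivity)) (mul_le_mul_of_nonneg_left ?_ (by norm_num))
            · exact FS_circle hr hr1 h2 hS N hTc (hT1 T hTb) θ
            · have hzr : σ₁ ≤ z.re := by
                have := (circle_re_bd (σ0 := σ0) hr θ 0).1
                rw [← hz] at this
                simp at this
                linarith
              refine (hC2 z hzr T hTc).trans ?_
              gcongr
              exact htail N
    have hsw := swap_int_le hcc hle (show (0:ℝ) ≤ 2 * Real.pi by positivity) hb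
    rwa [sub_zero] at hsw
  have hlow := (abs_le.mp (hC1 T)).1
  have hS3 : ∑ p ∈ S, 4 / κ' ^ 2 * ∫ t in T..(2 * T), ‖QQ (S.erase p) M d t‖ ^ 2 ≤
      T * X / 4 + ∑ p ∈ S, 4 / κ' ^ 2 * C3 p := by
    have : ∀ p ∈ S, 4 / κ' ^ 2 * ∫ t in T..(2 * T), ‖QQ (S.erase p) M d t‖ ^ 2 ≤
        4 / κ' ^ 2 * (T * (X / M)) + 4 / κ' ^ 2 * C3 p := by
      intro p hp
      rw [← mul_add]
      refine mul_le_mul_of_nonneg_left ?_ (by positivity)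
      have h5 := (abs_le.mp (hC3 p T)).2
      have h6 : (M:ℝ) ^ (S.erase p).card = X / M := by
        rw [eq_div_iff hM0.ne', ← pow_succ, Finset.card_erase_add_one hp]
      rw [h6] at h5
      linarith
    refine (Finset.sum_le_sum this).trans ?_
    rw [Finset.sum_add_distrib, Finset.sum_const, nsmul_eq_mul]
    refine add_le_add ?_ le_rfl
    have h7 : 16 * S.card / κ' ^ 2 ≤ M := hM.le
    have h8 : (S.card:ℝ) * (4 / κ' ^ 2 * (T * (X / M))) = (16 * S.card / κ' ^ 2) / M * (T * X / 4) := by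
      field_simp; ring
    rw [h8]
    have h9 : (16 * S.card / κ' ^ 2) / M ≤ 1 := by rw [div_le_one hM0]; exact h7
    exact mul_le_of_le_one_left (by positivity) h9
  have hfin : 1 / κ * (2 * Real.pi * (2 * X ^ 2 * (ε * T) + 2 * (T * (X * τ) + C2))) = T * X / 2 + 4 * Real.pi * C2 / κ := by
    rw [hε, hτ]
    field_simp
    ring
  have hm := mul_le_mul_of_nonneg_left hJint (show 0 ≤ 1 / κ by positivity)
  rw [hfin] at hm
  have hTX : 4 * CT < T * X := by
    have : 4 * CT / X < T := by linarith
    rwa [div_lt_iff₀ hX0] at this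
  have : T * X - C1 ≤ T * X / 2 + 4 * Real.pi * C2 / κ + (T * X / 4 + ∑ p ∈ S, 4 / κ' ^ 2 * C3 p) := by
    linarith
  rw [hCT] at hTX
  linarith


lemma unimod_split {c : ℂ} (hc : ‖c‖ ≤ 1) : ∃ δ : ℂ, ‖δ‖ ≤ 1 ∧ ‖c + δ‖ = 1 ∧ ‖c - δ‖ = 1 := by
  by_cases h0 : c = 0
  · exact ⟨1, by simp [h0]⟩
  have hp : 0 < ‖c‖ := norm_pos_iff.mpr h0
  set s := Real.sqrt (1 - ‖c‖ ^ 2) with hs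
  have hs2 : s ^ 2 = 1 - ‖c‖ ^ 2 := Real.sq_sqrt (by nlinarith)
  have hs0 : 0 ≤ s := Real.sqrt_nonneg _
  have key : ∀ x : ℝ, x ^ 2 = s ^ 2 → ‖c + c * ((x / ‖c‖ : ℝ) * I)‖ = 1 := by
    intro x hx
    have : c + c * ((x / ‖c‖ : ℝ) * I) = c * ((1 : ℝ) + (x / ‖c‖ : ℝ) * I) := by push_cast; ring
    rw [this, norm_mul, Complex.norm_add_mul_I]
    rw [← Real.sqrt_sq hp.le, ← Real.sqrt_mul (sq_nonneg _), Real.sqrt_eq_one, Real.sqrt_sq hp.le]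
    field_simp
    linarith
  refine ⟨c * ((s / ‖c‖ : ℝ) * I), ?_, key s rfl, ?_⟩
  · rw [norm_mul, norm_mul, norm_I, norm_real, mul_one, Real.norm_eq_abs, abs_of_nonneg (by positivity), mul_div_cancel₀ _ hp.ne']
    nlinarith
  · have := key (-s) (by ring)
    rw [← this]; congr 1; push_cast; ring

lemma round_unimod {V : Type*} [NormedAddCommGroup V] [InnerProductSpace ℂ V] (v : ℕ → V) (s : Finset ℕ)
    (c : ℕ → ℂ) (hc : ∀ j, ‖c j‖ ≤ 1) :
    ∃ c' : ℕ → ℂ, (∀ j, ‖c' j‖ = 1) ∧ ‖∑ j ∈ s, c' j • v j - ∑ j ∈ s, c j • v j‖ ^ 2 ≤ ∑ j ∈ s, ‖v j‖ ^ 2 := by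
  induction s using Finset.induction_on with
  | empty => exact ⟨fun _ => 1, by simp⟩
  | insert a s ha ih =>
    obtain ⟨c', h1, h2⟩ := ih
    obtain ⟨δ, hδ, hp, hm⟩ := unimod_split (hc a)
    set w := ∑ j ∈ s, c' j • v j - ∑ j ∈ s, c j • v j with hw
    have main : ∀ e : ℂ, ‖e‖ ≤ 1 → ‖c a + e‖ = 1 → RCLike.re (inner ℂ w (e • v a)) ≤ 0 →
        ∃ c' : ℕ → ℂ, (∀ j, ‖c' j‖ = 1) ∧ ‖∑ j ∈ insert a s, c' j • v j - ∑ j ∈ insert a s, c j • v j‖ ^ 2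
          ≤ ∑ j ∈ insert a s, ‖v j‖ ^ 2 := by
      intro e he1 he2 he3
      refine ⟨Function.update c' a (c a + e), ?_, ?_⟩
      · intro j
        by_cases hj : j = a
        · subst hj; simpa using he2
        · simpa [Function.update_of_ne hj] using h1 j
      · rw [Finset.sum_insert ha, Finset.sum_insert ha, Finset.sum_insert ha, Function.update_self]
        have e1 : ∑ j ∈ s, Function.update c' a (c a + e) j • v j = ∑ j ∈ s, c' j • v j := by
          refine Finset.sum_congr rfl fun j hj => ?_
          rw [Function.update_of_ne (by rintro rfl; exact ha hj)]
        have e2 : (c a + e) • v a + ∑ j ∈ s, c' j • v j - (c a • v a + ∑ j ∈ s, c j • v j) = w + e • v a := by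
          rw [hw, add_smul]; abel
        rw [e1, e2, norm_add_sq (𝕜 := ℂ), norm_smul, mul_pow]
        have : ‖e‖ ^ 2 * ‖v a‖ ^ 2 ≤ ‖v a‖ ^ 2 :=
          mul_le_of_le_one_left (by positivity) (pow_le_one₀ (norm_nonneg _) he1)
        linarith
    by_cases hsgn : RCLike.re (inner ℂ w (δ • v a)) ≤ 0
    · exact main δ hδ hp hsgn
    · refine main (-δ) (by rwa [norm_neg]) (by rwa [← sub_eq_add_neg]) ?_
      rw [neg_smul, inner_neg_right, map_neg]
      linarith

lemma ball_dense {V : Type*} [NormedAddCommGroup V] [InnerProductSpace ℂ V] (v : ℕ → V)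
    (hv : ∀ l : V →L[ℂ] ℂ, l ≠ 0 → ¬ Summable (fun j => ‖l (v j)‖)) (m1 : ℕ) (x : V) {ε : ℝ} (hε : 0 < ε) :
    ∃ m ≥ m1, ∃ c : ℕ → ℂ, (∀ j, ‖c j‖ ≤ 1) ∧ ‖∑ j ∈ Finset.Ico m1 m, c j • v j - x‖ < ε := by
  set C : Set V := {y | ∃ m ≥ m1, ∃ c : ℕ → ℂ, (∀ j, ‖c j‖ ≤ 1) ∧ y = ∑ j ∈ Finset.Ico m1 m, c j • v j} with hC
  have hext : ∀ m m' : ℕ, m1 ≤ m → m ≤ m' → ∀ c : ℕ → ℂ, (∀ j, ‖c j‖ ≤ 1) → ∃ c' : ℕ → ℂ, (∀ j, ‖c' j‖ ≤ 1) ∧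
      ∑ j ∈ Finset.Ico m1 m, c j • v j = ∑ j ∈ Finset.Ico m1 m', c' j • v j := by
    intro m m' h1 h2 c hc
    refine ⟨fun j => if j < m then c j else 0, fun j => ?_, ?_⟩
    · dsimp only; split_ifs
      · exact hc j
      · simp
    · rw [← Finset.sum_Ico_consecutive _ h1 h2]
      rw [Finset.sum_eq_zero (s := Finset.Ico m m'), add_zero]
      · refine Finset.sum_congr rfl fun j hj => ?_
        dsimp only
        rw [if_pos (Finset.mem_Ico.mp hj).2]
      · intro j hj
        have hjm : ¬ j < m := by have := (Finset.mem_Ico.mp hj).1; omega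
        dsimp only
        rw [if_neg hjm, zero_smul]
  have hconv : Convex ℝ C := by
    rintro y1 ⟨m, hm, c, hc, rfl⟩ y2 ⟨m', hm', c', hc', rfl⟩ a b ha hb hab
    obtain ⟨d, hd, e1⟩ := hext m (max m m') hm (le_max_left _ _) c hc
    obtain ⟨d', hd', e2⟩ := hext m' (max m m') hm' (le_max_right _ _) c' hc'
    refine ⟨max m m', le_trans hm (le_max_left _ _), fun j => a • d j + b • d' j, fun j => ?_, ?_⟩
    · refine (norm_add_le _ _).trans ?_
      rw [norm_smul, norm_smul, Real.norm_of_nonneg ha, Real.norm_of_nonneg hb]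
      nlinarith [hd j, hd' j]
    · rw [e1, e2, Finset.smul_sum, Finset.smul_sum, ← Finset.sum_add_distrib]
      refine Finset.sum_congr rfl fun j _ => ?_
      rw [add_smul, smul_assoc, smul_assoc]
  have hx : x ∈ closure C := by
    by_contra hx
    obtain ⟨f, u, h1, h2⟩ := RCLike.geometric_hahn_banach_closed_point (𝕜 := ℂ) hconv.closure isClosed_closure hx
    have h0 : (0:V) ∈ C := ⟨m1, le_rfl, fun _ => 0, by simp, by simp⟩
    have hu : 0 < u := by have := h1 0 (subset_closure h0); simpa using this
    have hf : f ≠ 0 := by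
      rintro rfl
      simp at h2; linarith
    apply hv f hf
    rw [← summable_nat_add_iff m1]
    refine summable_of_sum_range_le (c := u) (fun _ => norm_nonneg _) fun k => ?_
    have hc : ∀ z : ℂ, ∃ c : ℂ, ‖c‖ ≤ 1 ∧ c * z = ‖z‖ := by
      intro z
      by_cases hz : z = 0
      · exact ⟨0, by simp [hz]⟩
      · refine ⟨(starRingEnd ℂ) z / ‖z‖, ?_, ?_⟩
        · rw [norm_div, Complex.norm_conj, norm_real, norm_norm, div_self (norm_ne_zero_iff.mpr hz)]
        · have : (‖z‖ : ℂ) ≠ 0 := by exact_mod_cast norm_ne_zero_iff.mpr hz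
          rw [div_mul_eq_mul_div, Complex.conj_mul', sq, mul_div_assoc, div_self this, mul_one]
    choose ph hph1 hph2 using hc
    have hin : ∑ j ∈ Finset.Ico m1 (m1 + k), ph (f (v j)) • v j ∈ C :=
      ⟨m1 + k, by omega, fun j => ph (f (v j)), fun j => hph1 _, rfl⟩
    have h3 := h1 _ (subset_closure hin)
    rw [map_sum] at h3
    simp only [map_smul, smul_eq_mul, hph2] at h3
    rw [map_sum] at h3
    simp only [RCLike.re_to_complex, ofReal_re] at h3
    rw [Finset.sum_Ico_eq_sum_range] at h3
    simp only [Nat.add_sub_cancel_left] at h3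
    refine le_trans (le_of_eq ?_) h3.le
    refine Finset.sum_congr rfl fun j _ => by rw [add_comm]
  obtain ⟨y, ⟨m, hm, c, hc, rfl⟩, hy⟩ := Metric.mem_closure_iff.mp hx ε hε
  refine ⟨m, hm, c, hc, ?_⟩
  rwa [dist_comm, dist_eq_norm] at hy

lemma unimod_dense {V : Type*} [NormedAddCommGroup V] [InnerProductSpace ℂ V] (v : ℕ → V)
    (hv2 : Summable (fun j => ‖v j‖ ^ 2))
    (hv : ∀ l : V →L[ℂ] ℂ, l ≠ 0 → ¬ Summable (fun j => ‖l (v j)‖)) (m0 : ℕ) (x : V) {ε : ℝ} (hε : 0 < ε) :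
    ∃ m ≥ m0, ∃ c : ℕ → ℂ, (∀ j, ‖c j‖ = 1) ∧ ‖∑ j ∈ Finset.Ico m0 m, c j • v j - x‖ < ε := by
  obtain ⟨s, hs⟩ := (summable_iff_vanishing_norm.mp hv2) ((ε / 2) ^ 2) (by positivity)
  set m1 := max m0 (s.sup id + 1)
  have htail : ∀ M : ℕ, ∑ n ∈ Finset.Ico m1 M, ‖v n‖ ^ 2 < (ε / 2) ^ 2 := by
    intro M
    refine (le_abs_self _).trans_lt (hs _ ?_)
    rw [Finset.disjoint_left]
    intro n hn hns
    have h1 := (Finset.mem_Ico.mp hn).1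
    have h2 : n ≤ s.sup id := Finset.le_sup (f := id) hns
    have h3 : s.sup id + 1 ≤ m1 := le_max_right _ _
    omega
  have hm01 : m0 ≤ m1 := le_max_left _ _
  obtain ⟨m, hm, c, hc, hlt⟩ := ball_dense v hv m1 (x - ∑ j ∈ Finset.Ico m0 m1, v j) (half_pos hε)
  obtain ⟨c', hc', hlt'⟩ := round_unimod v (Finset.Ico m1 m) c hc
  have h4 : ‖∑ j ∈ Finset.Ico m1 m, c' j • v j - ∑ j ∈ Finset.Ico m1 m, c j • v j‖ < ε / 2 :=
    lt_of_pow_lt_pow_left₀ 2 (by positivity) (lt_of_le_of_lt hlt' (htail m))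
  refine ⟨m, hm01.trans hm, fun j => if j < m1 then 1 else c' j, fun j => ?_, ?_⟩
  · dsimp only; split_ifs
    · simp
    · exact hc' j
  · rw [← Finset.sum_Ico_consecutive _ hm01 hm]
    have e1 : ∑ j ∈ Finset.Ico m0 m1, (if j < m1 then (1:ℂ) else c' j) • v j = ∑ j ∈ Finset.Ico m0 m1, v j :=
      Finset.sum_congr rfl fun j hj => by rw [if_pos (Finset.mem_Ico.mp hj).2, one_smul]
    have e2 : ∑ j ∈ Finset.Ico m1 m, (if j < m1 then (1:ℂ) else c' j) • v j = ∑ j ∈ Finset.Ico m1 m, c' j • v j :=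
      Finset.sum_congr rfl fun j hj => by rw [if_neg (by have := (Finset.mem_Ico.mp hj).1; omega)]
    rw [e1, e2]
    have e3 : ∑ j ∈ Finset.Ico m0 m1, v j + ∑ j ∈ Finset.Ico m1 m, c' j • v j - x =
      (∑ j ∈ Finset.Ico m1 m, c' j • v j - ∑ j ∈ Finset.Ico m1 m, c j • v j) +
        (∑ j ∈ Finset.Ico m1 m, c j • v j - (x - ∑ j ∈ Finset.Ico m0 m1, v j)) := by abel
    rw [e3]
    refine (norm_add_le _ _).trans_lt ?_
    linarith


/-- product of jets -/
noncomputable def Mj (a b : ℕ → ℂ) : ℕ → ℂ := fun k => ∑ i ∈ Finset.range (k + 1), (k.choose i : ℂ) * a i * b (k - i)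

/-- exponential of jets -/
noncomputable def Ej (b : ℕ → ℂ) : ℕ → ℂ
  | 0 => cexp (b 0)
  | k + 1 => ∑ j : Fin (k + 1), (k.choose j : ℂ) * b (j + 1) * Ej b (k - j)
termination_by k => k
decreasing_by omega

/-- inverse of the exponential of jets -/
noncomputable def Lj (a : ℕ → ℂ) : ℕ → ℂ
  | 0 => Complex.log (a 0)
  | k + 1 => (a (k + 1) - ∑ j : Fin k, (k.choose j : ℂ) * Lj a (j + 1) * a (k - j)) / a 0
termination_by k => k
decreasing_by omega

lemma Ej_succ (b : ℕ → ℂ) (k : ℕ) : Ej b (k + 1) = ∑ j ∈ Finset.range (k + 1), (k.choose j : ℂ) * b (j + 1) * Ej b (k - j) := by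
  rw [Ej, ← Fin.sum_univ_eq_sum_range (fun j => (k.choose j : ℂ) * b (j + 1) * Ej b (k - j))]

lemma Ej_cont (k : ℕ) : Continuous (fun b : ℕ → ℂ => Ej b k) := by
  induction k using Nat.strong_induction_on with
  | _ k ih =>
    cases k with
    | zero => simp only [Ej]; fun_prop
    | succ k =>
      simp only [Ej_succ]
      refine continuous_finsetSum _ fun j _ => ?_
      exact (continuous_const.mul (continuous_apply _)).mul (ih _ (by omega))

lemma Mj_cont (k : ℕ) : Continuous (fun p : (ℕ → ℂ) × (ℕ → ℂ) => Mj p.1 p.2 k) := by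
  unfold Mj
  fun_prop

lemma Ej_Lj (a : ℕ → ℂ) (ha : a 0 ≠ 0) : Ej (Lj a) = a := by
  funext k
  induction k using Nat.strong_induction_on with
  | _ k ih =>
    cases k with
    | zero => rw [Ej, Lj, Complex.exp_log ha]
    | succ k =>
      rw [Ej_succ, Finset.sum_range_succ]
      have h1 : ∑ j ∈ Finset.range k, (k.choose j : ℂ) * Lj a (j + 1) * Ej (Lj a) (k - j)
          = ∑ j : Fin k, (k.choose j : ℂ) * Lj a (j + 1) * a (k - j) := by
        rw [← Fin.sum_univ_eq_sum_range (fun j => (k.choose j : ℂ) * Lj a (j + 1) * Ej (Lj a) (k - j))]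
        refine Finset.sum_congr rfl fun j _ => ?_
        rw [ih _ (by omega)]
      rw [h1, Nat.sub_self, ih 0 (by omega), Nat.choose_self, Lj]
      push_cast
      field_simp
      ring

lemma jet_mul {f g : ℂ → ℂ} {s : ℂ} (hf : AnalyticAt ℂ f s) (hg : AnalyticAt ℂ g s) (k : ℕ) :
    iteratedDeriv k (fun z => f z * g z) s = Mj (fun j => iteratedDeriv j f s) (fun j => iteratedDeriv j g s) k := by
  have := iteratedDeriv_mul (n := k) (hf.contDiffAt (n := k)) (hg.contDiffAt (n := k))
  unfold Mj
  rw [← this]; rfl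

lemma jet_exp {f : ℂ → ℂ} {s : ℂ} (hf : AnalyticAt ℂ f s) (k : ℕ) :
    iteratedDeriv k (fun z => cexp (f z)) s = Ej (fun j => iteratedDeriv j f s) k := by
  induction k using Nat.strong_induction_on with
  | _ k ih =>
    cases k with
    | zero => simp [Ej]
    | succ k =>
      rw [iteratedDeriv_succ']
      have h1 : deriv (fun z => cexp (f z)) =ᶠ[𝓝 s] fun z => deriv f z * cexp (f z) := by
        filter_upwards [hf.eventually_analyticAt] with z hz
        rw [(hz.differentiableAt.hasDerivAt.cexp).deriv]; ring
      rw [h1.iteratedDeriv_eq k, jet_mul hf.deriv hf.cexp', Ej_succ, Mj]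
      refine Finset.sum_congr rfl fun j hj => ?_
      rw [ih _ (by omega), iteratedDeriv_succ']

lemma Mj_one (a : ℕ → ℂ) : Mj a (fun j => if j = 0 then 1 else 0) = a := by
  funext k
  unfold Mj
  rw [Finset.sum_range_succ, Finset.sum_eq_zero]
  · simp
  · intro i hi
    have := Finset.mem_range.mp hi
    have h2 : k - i ≠ 0 := by omega
    dsimp only
    rw [if_neg h2, mul_zero]

/-- stability of the jet of a product with an exponential -/
lemma jet_stab (a : ℕ → ℂ) (ha : a 0 ≠ 0) (n : ℕ) {δ : ℝ} (hδ : 0 < δ) :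
    ∃ b : ℕ → ℂ, ∃ N : ℕ, ∃ η > 0, ∀ u w : ℕ → ℂ, (∀ k ≤ N, ‖u k - b k‖ < η) →
      (∀ k ≤ N, ‖w k - (if k = 0 then 1 else 0)‖ < η) → ∀ k ≤ n, ‖Mj (Ej u) w k - a k‖ < δ := by
  refine ⟨Lj a, ?_⟩
  have hc : ∀ k, Continuous (fun p : (ℕ → ℂ) × (ℕ → ℂ) => Mj (Ej p.1) p.2 k) := fun k =>
    (Mj_cont k).comp ((continuous_pi (fun j => (Ej_cont j).comp continuous_fst)).prodMk continuous_snd)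
  have hev : ∀ᶠ p : (ℕ → ℂ) × (ℕ → ℂ) in 𝓝 (Lj a, fun j => if j = 0 then 1 else 0),
      ∀ k ∈ Finset.range (n + 1), ‖Mj (Ej p.1) p.2 k - a k‖ < δ := by
    rw [Filter.eventually_all_finset]
    intro k _
    have h := (hc k).tendsto (Lj a, fun j => if j = 0 then 1 else 0)
    simp only [Ej_Lj a ha, Mj_one] at h
    have := (Metric.tendsto_nhds.mp h) δ hδ
    simpa only [dist_eq_norm] using this
  by_contra hcon
  push Not at hcon
  have hcon' : ∀ N : ℕ, ∃ u w : ℕ → ℂ, (∀ k ≤ N, ‖u k - Lj a k‖ < 1 / ((N : ℝ) + 1)) ∧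
      (∀ k ≤ N, ‖w k - (if k = 0 then 1 else 0)‖ < 1 / ((N : ℝ) + 1)) ∧ ∃ k ≤ n, δ ≤ ‖Mj (Ej u) w k - a k‖ := by
    intro N
    obtain ⟨u, w, h1, h2, h3⟩ := hcon N (1 / ((N : ℝ) + 1)) (by positivity)
    exact ⟨u, w, h1, h2, h3⟩
  choose u w hu hw hk using hcon'
  have hlim : ∀ (f : ℕ → ℕ → ℂ) (g : ℕ → ℂ), (∀ N, ∀ k ≤ N, ‖f N k - g k‖ < 1 / ((N : ℝ) + 1)) → Tendsto f atTop (𝓝 g) := by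
    intro f g h
    rw [tendsto_pi_nhds]
    intro k
    rw [tendsto_iff_norm_sub_tendsto_zero]
    refine squeeze_zero' (Eventually.of_forall fun _ => norm_nonneg _) ?_ tendsto_one_div_add_atTop_nhds_zero_nat
    filter_upwards [eventually_ge_atTop k] with N hN
    exact (h N k hN).le
  have ht := (hlim u _ hu).prodMk_nhds (hlim w (fun j => if j = 0 then 1 else 0) hw)
  obtain ⟨N, hN⟩ := (ht.eventually hev).exists
  obtain ⟨k, hkn, hk2⟩ := hk N
  exact absurd (hN k (Finset.mem_range.mpr (by omega))) (not_lt.mpr hk2)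


/-- iterates of `w d/dw` applied to `-log (1-w)` -/
noncomputable def Gk : ℕ → ℂ → ℂ
  | 0 => fun w => -Complex.log (1 - w)
  | k + 1 => fun w => w * deriv (Gk k) w

lemma Gk_diff (k : ℕ) : DifferentiableOn ℂ (Gk k) (Metric.ball 0 1) := by
  induction k with
  | zero =>
    intro w hw
    have hw' : ‖w‖ < 1 := by simpa using hw
    refine DifferentiableAt.differentiableWithinAt ?_
    unfold Gk
    refine DifferentiableAt.neg (DifferentiableAt.clog (by fun_prop) ?_)
    have := Complex.mem_slitPlane_of_norm_lt_one (z := -w) (by simpa using hw')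
    rwa [← sub_eq_add_neg] at this
  | succ k ih =>
    unfold Gk
    exact differentiableOn_id.mul (ih.deriv Metric.isOpen_ball)

lemma Gk_H (k : ℕ) : ∃ H : ℂ → ℂ, DifferentiableOn ℂ H (Metric.ball 0 1) ∧
    ∀ w ∈ Metric.ball (0:ℂ) 1, Gk k w = w + w ^ 2 * H w := by
  have hn : Metric.ball (0:ℂ) 1 ∈ 𝓝 (0:ℂ) := Metric.ball_mem_nhds _ one_pos
  induction k with
  | zero =>
    set D := dslope (Gk 0) 0 with hD
    have hDd : DifferentiableOn ℂ D (Metric.ball 0 1) := (Complex.differentiableOn_dslope hn).mpr (Gk_diff 0)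
    refine ⟨dslope D 0, (Complex.differentiableOn_dslope hn).mpr hDd, fun w hw => ?_⟩
    have h0 : Gk 0 0 = 0 := by simp [Gk]
    have hD0 : D 0 = 1 := by
      rw [hD, dslope_same]
      have h : HasDerivAt (fun w : ℂ => -Complex.log (1 - w)) (-((-1) / (1 - 0))) 0 :=
        (((hasDerivAt_id' (0:ℂ)).const_sub 1).clog (by simp)).neg
      unfold Gk
      rw [h.deriv]; simp
    have e1 := sub_smul_dslope (Gk 0) 0 w
    have e2 := sub_smul_dslope D 0 w
    simp only [sub_zero, smul_eq_mul, h0, hD0] at e1 e2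
    rw [← hD] at e1
    rw [← e1]
    linear_combination (-w) * e2
  | succ k ih =>
    obtain ⟨H, hH, hk⟩ := ih
    refine ⟨fun w => 2 * H w + w * deriv H w, ?_, fun w hw => ?_⟩
    · exact (hH.const_mul 2).add (differentiableOn_id.mul (hH.deriv Metric.isOpen_ball))
    · have hev : Gk k =ᶠ[𝓝 w] fun w => w + w ^ 2 * H w := by
        filter_upwards [Metric.isOpen_ball.mem_nhds hw] with x hx using hk x hx
      have hHw : HasDerivAt H (deriv H w) w := (hH.differentiableAt (Metric.isOpen_ball.mem_nhds hw)).hasDerivAt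
      have hd : HasDerivAt (fun w => w + w ^ 2 * H w) _ w := (hasDerivAt_id' w).add ((hasDerivAt_pow 2 w).mul hHw)
      show w * deriv (Gk k) w = _
      rw [hev.deriv_eq, hd.deriv]
      push_cast
      ring

lemma Gk_bound (k : ℕ) : ∃ C : ℝ, 0 ≤ C ∧ ∀ w : ℂ, ‖w‖ ≤ 3 / 4 → ‖Gk k w - w‖ ≤ C * ‖w‖ ^ 2 := by
  obtain ⟨H, hH, hk⟩ := Gk_H k
  have hc : ContinuousOn H (Metric.closedBall 0 (3 / 4)) :=
    hH.continuousOn.mono (Metric.closedBall_subset_ball (by norm_num))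
  obtain ⟨C, hC⟩ := (isCompact_closedBall (0:ℂ) (3 / 4)).exists_bound_of_continuousOn hc
  refine ⟨max C 0, le_max_right _ _, fun w hw => ?_⟩
  rw [hk w (by simp; linarith), add_sub_cancel_left, norm_mul, norm_pow, mul_comm]
  gcongr
  exact (hC w (by simpa using hw)).trans (le_max_left _ _)

lemma cpow_lt_one {p : ℕ} (hp : p.Prime) {c : ℂ} (hc : ‖c‖ = 1) {z : ℂ} (hz : 0 < z.re) : ‖c * (p:ℂ) ^ (-z)‖ < 1 := by
  rw [norm_mul, hc, one_mul, Complex.norm_natCast_cpow_of_pos hp.pos, Complex.neg_re]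
  exact Real.rpow_lt_one_of_one_lt_of_neg (by exact_mod_cast hp.one_lt) (by linarith)

lemma halfplane_nhds {z : ℂ} (hz : 0 < z.re) : ∀ᶠ w : ℂ in 𝓝 z, 0 < w.re :=
  (isOpen_lt continuous_const Complex.continuous_re).mem_nhds hz

lemma Lterm_deriv {p : ℕ} (hp : p.Prime) {c : ℂ} (hc : ‖c‖ = 1) (k : ℕ) : ∀ z : ℂ, 0 < z.re →
    iteratedDeriv k (fun z => Gk 0 (c * (p:ℂ) ^ (-z))) z = (-(Real.log p : ℂ)) ^ k * Gk k (c * (p:ℂ) ^ (-z)) := by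
  induction k with
  | zero => intro z hz; simp
  | succ k ih =>
    intro z hz
    rw [iteratedDeriv_succ]
    have hev : iteratedDeriv k (fun z => Gk 0 (c * (p:ℂ) ^ (-z))) =ᶠ[𝓝 z]
        fun z => (-(Real.log p : ℂ)) ^ k * Gk k (c * (p:ℂ) ^ (-z)) := by
      filter_upwards [halfplane_nhds hz] with w hw using ih w hw
    rw [hev.deriv_eq]
    have hp0 : (p:ℂ) ≠ 0 := by exact_mod_cast hp.ne_zero
    have h1 : HasDerivAt (fun z : ℂ => c * (p:ℂ) ^ (-z)) (c * ((p:ℂ) ^ (-z) * Complex.log p * (-1))) z :=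
      (((hasDerivAt_id' z).neg).const_cpow (Or.inl hp0)).const_mul c
    have h2 : HasDerivAt (Gk k) (deriv (Gk k) (c * (p:ℂ) ^ (-z))) (c * (p:ℂ) ^ (-z)) :=
      ((Gk_diff k).differentiableAt (Metric.isOpen_ball.mem_nhds (by simpa using cpow_lt_one hp hc hz))).hasDerivAt
    have h3 := (HasDerivAt.comp z h2 h1).const_mul ((-(Real.log p : ℂ)) ^ k)
    rw [show (fun z => (-(Real.log p : ℂ)) ^ k * Gk k (c * (p:ℂ) ^ (-z))) =
      fun y => (-(Real.log p : ℂ)) ^ k * (Gk k ∘ fun z : ℂ => c * (p:ℂ) ^ (-z)) y from rfl, h3.deriv]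
    show _ = _ * ((c * (p:ℂ) ^ (-z)) * deriv (Gk k) (c * (p:ℂ) ^ (-z)))
    rw [← Complex.natCast_log]
    push_cast
    ring

lemma Lterm_analytic {p : ℕ} (hp : p.Prime) {c : ℂ} (hc : ‖c‖ = 1) {z : ℂ} (hz : 0 < z.re) :
    AnalyticAt ℂ (fun z => Gk 0 (c * (p:ℂ) ^ (-z))) z := by
  have hp0 : (p:ℂ) ≠ 0 := by exact_mod_cast hp.ne_zero
  rw [Complex.analyticAt_iff_eventually_differentiableAt]
  filter_upwards [halfplane_nhds hz] with w hw
  have h2 : DifferentiableAt ℂ (Gk 0) (c * (p:ℂ) ^ (-w)) :=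
      ((Gk_diff 0).differentiableAt (Metric.isOpen_ball.mem_nhds (by simpa using cpow_lt_one hp hc hw)))
  have h1 : DifferentiableAt ℂ (fun z : ℂ => c * (p:ℂ) ^ (-z)) w :=
    ((((hasDerivAt_id' w).neg).const_cpow (Or.inl hp0)).const_mul c).differentiableAt
  exact DifferentiableAt.comp (g := Gk 0) (f := fun z : ℂ => c * (p:ℂ) ^ (-z)) w h2 h1

/-- logarithm of the twisted finite Euler product -/
noncomputable def LS (S : Finset ℕ) (c : ℕ → ℂ) (z : ℂ) : ℂ := ∑ p ∈ S, Gk 0 (c p * (p:ℂ) ^ (-z))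

lemma LS_jet {S : Finset ℕ} (hS : ∀ p ∈ S, p.Prime) {c : ℕ → ℂ} (hc : ∀ p, ‖c p‖ = 1) {z : ℂ} (hz : 0 < z.re) (k : ℕ) :
    iteratedDeriv k (LS S c) z = ∑ p ∈ S, (-(Real.log p : ℂ)) ^ k * Gk k (c p * (p:ℂ) ^ (-z)) := by
  unfold LS
  rw [iteratedDeriv_fun_sum]
  · exact Finset.sum_congr rfl fun p hp => Lterm_deriv (hS p hp) (hc p) k z hz
  · exact fun p hp => (Lterm_analytic (hS p hp) (hc p) hz).contDiffAt

lemma LS_analytic {S : Finset ℕ} (hS : ∀ p ∈ S, p.Prime) {c : ℕ → ℂ} (hc : ∀ p, ‖c p‖ = 1) {z : ℂ} (hz : 0 < z.re) :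
    AnalyticAt ℂ (LS S c) z := by
  unfold LS
  exact Finset.analyticAt_fun_sum _ fun p hp => Lterm_analytic (hS p hp) (hc p) hz

lemma LS_exp {S : Finset ℕ} (hS : ∀ p ∈ S, p.Prime) {c : ℕ → ℂ} (hc : ∀ p, ‖c p‖ = 1) {z : ℂ} (hz : 0 < z.re) :
    cexp (LS S c z) * ∏ p ∈ S, (1 - c p * (p:ℂ) ^ (-z)) = 1 := by
  unfold LS
  rw [Complex.exp_sum, ← Finset.prod_mul_distrib]
  refine Finset.prod_eq_one fun p hp => ?_
  have h := cpow_lt_one (hS p hp) (hc p) hz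
  have hne : 1 - c p * (p:ℂ) ^ (-z) ≠ 0 := by
    intro h0
    rw [← sub_eq_zero.mp h0] at h; simp at h
  show cexp (-Complex.log (1 - c p * (p:ℂ) ^ (-z))) * _ = 1
  rw [Complex.exp_neg, Complex.exp_log hne, inv_mul_cancel₀ hne]


lemma sum_log (k : ℕ) {s : ℝ} (hs : 1 < s) : Summable fun j : ℕ => (Real.log j) ^ k * (j:ℝ) ^ (-s) := by
  have h1 : Summable fun j : ℕ => (j:ℝ) ^ (-((1 + s) / 2)) := Real.summable_nat_rpow.mpr (by linarith)
  refine summable_of_isBigO_nat h1 ?_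
  have h2 := (isLittleO_log_rpow_rpow_atTop (k:ℝ) (show 0 < (s - 1) / 2 by linarith)).isBigO
  have h3 := h2.comp_tendsto tendsto_natCast_atTop_atTop
  have h4 := h3.mul (Asymptotics.isBigO_refl (fun j : ℕ => (j:ℝ) ^ (-s)) atTop)
  refine (h4.congr' ?_ ?_)
  · filter_upwards with j
    simp [Real.rpow_natCast]
  · filter_upwards [eventually_gt_atTop 0] with j hj
    have : (0:ℝ) < j := by exact_mod_cast hj
    simp only [Function.comp]
    rw [← Real.rpow_add this]; congr 1; ring

/-- jet vectors of `p^{-s}` -/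
noncomputable def vP (n : ℕ) (σ : ℝ) (p : ℕ) : EuclideanSpace ℂ (Fin (n + 1)) :=
  if p.Prime then WithLp.toLp 2 (fun k : Fin (n + 1) => (-(Real.log p : ℂ)) ^ (k:ℕ) * (p:ℂ) ^ (-(σ:ℂ))) else 0

lemma norm_p_cpow {p : ℕ} (hp : p.Prime) (σ : ℝ) : ‖(p:ℂ) ^ (-(σ:ℂ))‖ = (p:ℝ) ^ (-σ) := by
  rw [Complex.norm_natCast_cpow_of_pos hp.pos]; simp

lemma vP_sq (n : ℕ) {σ : ℝ} (hσ : 1 / 2 < σ) : Summable (fun p => ‖vP n σ p‖ ^ 2) := by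
  have h1 : Summable fun p : ℕ => ∑ k : Fin (n + 1), (Real.log p) ^ (2 * (k:ℕ)) * (p:ℝ) ^ (-(2 * σ)) :=
    summable_sum fun k _ => sum_log _ (by linarith)
  refine Summable.of_nonneg_of_le (fun _ => by positivity) (fun p => ?_) h1
  unfold vP
  split_ifs with hp
  · rw [EuclideanSpace.norm_sq_eq]
    refine Finset.sum_le_sum fun k _ => le_of_eq ?_
    simp only [norm_mul, norm_pow, norm_neg, norm_p_cpow hp, norm_real, Real.norm_eq_abs]
    rw [mul_pow, ← pow_mul, mul_comm (k:ℕ) 2, pow_mul, sq_abs, ← pow_mul, ← Real.rpow_natCast ((p:ℝ) ^ (-σ)) 2, ← Real.rpow_mul (by positivity)]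
    congr 2; push_cast; ring
  · simp only [norm_zero]
    rw [zero_pow two_ne_zero]
    refine Finset.sum_nonneg fun k _ => ?_
    rw [pow_mul]; positivity

lemma poly_low (A : Polynomial ℂ) (hA : A ≠ 0) : ∃ c > 0, ∀ᶠ p : ℕ in atTop, c ≤ ‖A.eval (-(Real.log p : ℂ))‖ := by
  by_cases hd : 0 < A.degree
  · refine ⟨1, one_pos, ?_⟩
    have ht : Tendsto (fun p : ℕ => ‖(-(Real.log p : ℂ))‖) atTop atTop := by
      simp only [norm_neg, norm_real]
      exact tendsto_norm_atTop_atTop.comp (Real.tendsto_log_atTop.comp tendsto_natCast_atTop_atTop)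
    exact (Polynomial.tendsto_norm_atTop A hd ht).eventually_ge_atTop 1
  · have h := Polynomial.eq_C_of_degree_le_zero (not_lt.mp hd)
    have h0 : A.coeff 0 ≠ 0 := by
      intro h0; rw [h0] at h; simp at h; exact hA h
    refine ⟨‖A.coeff 0‖, norm_pos_iff.mpr h0, Eventually.of_forall fun p => ?_⟩
    rw [h]; simp

lemma vP_not (n : ℕ) {σ : ℝ} (hσ : σ < 1) (l : EuclideanSpace ℂ (Fin (n + 1)) →L[ℂ] ℂ) (hl : l ≠ 0) :
    ¬ Summable (fun p => ‖l (vP n σ p)‖) := by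
  intro hs
  have hlv : ∀ v, l v = ∑ k, v k * l (EuclideanSpace.single k 1) := by
    intro v
    have hv : v = ∑ k, v k • EuclideanSpace.single k (1:ℂ) := by
      ext i
      simp [Finset.sum_apply, Pi.single_apply]
    conv_lhs => rw [hv]
    rw [map_sum]
    simp
  set A : Polynomial ℂ := ∑ k : Fin (n + 1), Polynomial.monomial (k:ℕ) (l (EuclideanSpace.single k 1)) with hA
  have hA0 : A ≠ 0 := by
    intro h0
    apply hl
    ext v
    rw [hlv v]
    refine Finset.sum_eq_zero fun k _ => ?_
    have : A.coeff (k:ℕ) = l (EuclideanSpace.single k 1) := by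
      rw [hA, Polynomial.finsetSum_coeff, Finset.sum_eq_single k]
      · simp
      · intro b _ hb
        rw [Polynomial.coeff_monomial, if_neg (fun h => hb (Fin.ext h))]
      · simp
    rw [← this, h0]; simp
  obtain ⟨c, hc, hev⟩ := poly_low A hA0
  apply not_summable_one_div_on_primes
  refine Summable.of_norm_bounded_eventually_nat (hs.mul_left (1 / c)) ?_
  filter_upwards [hev] with p hp
  by_cases hpp : p.Prime
  · rw [Set.indicator_of_mem (by exact hpp)]
    have h1 : l (vP n σ p) = (p:ℂ) ^ (-(σ:ℂ)) * A.eval (-(Real.log p : ℂ)) := by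
      rw [hlv, hA, Polynomial.eval_finsetSum, Finset.mul_sum]
      refine Finset.sum_congr rfl fun k _ => ?_
      unfold vP
      rw [if_pos hpp, Polynomial.eval_monomial]
      dsimp only
      ring
    rw [h1, norm_mul, norm_p_cpow hpp]
    have hp1 : (1:ℝ) ≤ p := by exact_mod_cast hpp.one_lt.le
    have h2 : (1:ℝ) / p ≤ (p:ℝ) ^ (-σ) := by
      rw [one_div, ← Real.rpow_neg_one]
      exact Real.rpow_le_rpow_of_exponent_le hp1 (by linarith)
    rw [Real.norm_of_nonneg (by positivity)]
    calc (1:ℝ) / p ≤ (p:ℝ) ^ (-σ) := h2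
      _ = 1 / c * ((p:ℝ) ^ (-σ) * c) := by field_simp
      _ ≤ _ := by gcongr
  · rw [Set.indicator_of_notMem (by exact hpp), norm_zero]; positivity


lemma tail_small {W : ℕ → ℝ} (hW : Summable W) (y0 : ℕ) {ε : ℝ} (hε : 0 < ε) :
    ∃ m1 > y0, ∀ m, ∑ p ∈ Finset.Ico m1 m, W p < ε := by
  obtain ⟨s, hs⟩ := summable_iff_vanishing_norm.mp hW ε hε
  refine ⟨max (y0 + 1) (s.sup id + 1), by have := le_max_left (y0 + 1) (s.sup id + 1); omega, fun m => ?_⟩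
  refine lt_of_le_of_lt (le_abs_self _) (hs _ ?_)
  rw [Finset.disjoint_left]
  intro a ha has
  have h1 := Finset.le_sup (f := id) has
  have h2 := (Finset.mem_Ico.mp ha).1
  have h3 := le_max_right (y0 + 1) (s.sup id + 1)
  simp only [id] at h1
  omega

lemma p_rpow_le {p : ℕ} (hp : p.Prime) {σ : ℝ} (hσ : 1 / 2 < σ) : (p:ℝ) ^ (-σ) ≤ 3 / 4 := by
  have h2 : (2:ℝ) ≤ p := by exact_mod_cast hp.two_le
  calc (p:ℝ) ^ (-σ) ≤ (p:ℝ) ^ (-(1 / 2) : ℝ) := Real.rpow_le_rpow_of_exponent_le (by linarith) (by linarith)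
    _ ≤ (2:ℝ) ^ (-(1 / 2) : ℝ) := Real.rpow_le_rpow_of_nonpos (by norm_num) h2 (by norm_num)
    _ ≤ 3 / 4 := by
      rw [Real.rpow_neg (by norm_num), ← Real.sqrt_eq_rpow]
      have : (4 / 3 : ℝ) ≤ Real.sqrt 2 := Real.le_sqrt_of_sq_le (by norm_num)
      calc (Real.sqrt 2)⁻¹ ≤ (4 / 3 : ℝ)⁻¹ := by gcongr
        _ = 3 / 4 := by norm_num

lemma targets (N : ℕ) {σ : ℝ} (hσ : 1 / 2 < σ) (hσ1 : σ < 1) (b : ℕ → ℂ) {η : ℝ} (hη : 0 < η) (y0 : ℕ) :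
    ∃ S : Finset ℕ, (∀ p ∈ S, p.Prime) ∧ (∀ p : ℕ, p.Prime → p ≤ y0 → p ∈ S) ∧
      ∃ c : ℕ → ℂ, (∀ p, ‖c p‖ = 1) ∧ ∀ k ≤ N, ‖iteratedDeriv k (LS S c) σ - b k‖ < η := by
  choose C hC0 hC using Gk_bound
  set W : ℕ → ℝ := fun p => ∑ k ∈ Finset.range (N + 1), C k * ((Real.log p) ^ k * (p:ℝ) ^ (-(2 * σ))) with hWdef
  have hlog : ∀ p : ℕ, 0 ≤ Real.log p := fun p => Real.log_natCast_nonneg p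
  have hW : Summable W := summable_sum fun k _ => (sum_log k (by linarith)).mul_left _
  have hW0 : ∀ p, 0 ≤ W p := fun p => Finset.sum_nonneg fun k _ => by
    have := hlog p; have := hC0 k; positivity
  obtain ⟨m1, hm1, htail⟩ := tail_small hW y0 (half_pos hη)
  set g : ℕ → ℂ → ℕ → ℂ := fun k c p => if p.Prime then (-(Real.log p : ℂ)) ^ k * Gk k (c * (p:ℂ) ^ (-(σ:ℂ))) else 0 with hg
  set x : EuclideanSpace ℂ (Fin (N + 1)) := WithLp.toLp 2 (fun k => b k - ∑ p ∈ Finset.range m1, g k 1 p) with hx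
  obtain ⟨m, hm, c', hc', hclose⟩ := unimod_dense (vP N σ) (vP_sq N hσ) (vP_not N hσ1) m1 x (half_pos hη)
  have hc1 : ∀ p, ‖(if p < m1 then (1:ℂ) else c' p)‖ = 1 := by
    intro p; split_ifs
    · simp
    · exact hc' p
  have hSp : ∀ p ∈ (Finset.range m).filter Nat.Prime, p.Prime := fun p hp => (Finset.mem_filter.mp hp).2
  refine ⟨(Finset.range m).filter Nat.Prime, hSp, ?_, fun p => if p < m1 then 1 else c' p, hc1, ?_⟩
  · intro p hp hpy
    exact Finset.mem_filter.mpr ⟨Finset.mem_range.mpr (by omega), hp⟩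
  intro k hk
  rw [LS_jet hSp hc1 (by simp; linarith) k, Finset.sum_filter, ← Finset.sum_range_add_sum_Ico _ hm]
  have e1 : ∑ p ∈ Finset.range m1, (if p.Prime then (-(Real.log p : ℂ)) ^ k * Gk k ((if p < m1 then (1:ℂ) else c' p) * (p:ℂ) ^ (-(σ:ℂ))) else 0)
      = ∑ p ∈ Finset.range m1, g k 1 p := by
    refine Finset.sum_congr rfl fun p hp => ?_
    rw [if_pos (Finset.mem_range.mp hp)]
  have e2 : ∑ p ∈ Finset.Ico m1 m, (if p.Prime then (-(Real.log p : ℂ)) ^ k * Gk k ((if p < m1 then (1:ℂ) else c' p) * (p:ℂ) ^ (-(σ:ℂ))) else 0)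
      = ∑ p ∈ Finset.Ico m1 m, g k (c' p) p := by
    refine Finset.sum_congr rfl fun p hp => ?_
    rw [if_neg (not_lt.mpr (Finset.mem_Ico.mp hp).1)]
  rw [e1, e2]
  set kf : Fin (N + 1) := ⟨k, by omega⟩ with hkf
  have h1 : ‖∑ p ∈ Finset.Ico m1 m, c' p * vP N σ p kf - (b k - ∑ p ∈ Finset.range m1, g k 1 p)‖ < η / 2 := by
    refine lt_of_le_of_lt ?_ hclose
    have := PiLp.norm_apply_le (∑ j ∈ Finset.Ico m1 m, c' j • vP N σ j - x) kf
    refine le_trans (le_of_eq ?_) this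
    congr 1
    simp [hx, hkf]
  have h2 : ‖∑ p ∈ Finset.Ico m1 m, g k (c' p) p - ∑ p ∈ Finset.Ico m1 m, c' p * vP N σ p kf‖ < η / 2 := by
    rw [← Finset.sum_sub_distrib]
    refine lt_of_le_of_lt (norm_sum_le _ _) (lt_of_le_of_lt ?_ (htail m))
    refine Finset.sum_le_sum fun p _ => ?_
    by_cases hp : p.Prime
    · have hv : vP N σ p kf = (-(Real.log p : ℂ)) ^ k * (p:ℂ) ^ (-(σ:ℂ)) := by
        unfold vP; rw [if_pos hp]
      have hgk : g k (c' p) p = (-(Real.log p : ℂ)) ^ k * Gk k (c' p * (p:ℂ) ^ (-(σ:ℂ))) := by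
        rw [hg]; dsimp only; rw [if_pos hp]
      have hw : ‖c' p * (p:ℂ) ^ (-(σ:ℂ))‖ = (p:ℝ) ^ (-σ) := by rw [norm_mul, hc', one_mul, norm_p_cpow hp]
      rw [hv, hgk, show (-(Real.log p : ℂ)) ^ k * Gk k (c' p * (p:ℂ) ^ (-(σ:ℂ))) - c' p * ((-(Real.log p : ℂ)) ^ k * (p:ℂ) ^ (-(σ:ℂ)))
        = (-(Real.log p : ℂ)) ^ k * (Gk k (c' p * (p:ℂ) ^ (-(σ:ℂ))) - c' p * (p:ℂ) ^ (-(σ:ℂ))) by ring, norm_mul, norm_pow, norm_neg,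
        norm_real, Real.norm_of_nonneg (hlog p)]
      have hb := hC k (c' p * (p:ℂ) ^ (-(σ:ℂ))) (by rw [hw]; exact p_rpow_le hp hσ)
      rw [hw, ← Real.rpow_natCast ((p:ℝ) ^ (-σ)) 2, ← Real.rpow_mul (by positivity)] at hb
      have hs : C k * ((Real.log p) ^ k * (p:ℝ) ^ (-(2 * σ))) ≤ W p :=
        Finset.single_le_sum (f := fun k => C k * ((Real.log p) ^ k * (p:ℝ) ^ (-(2 * σ)))) (fun j _ => by
          have := hlog p; have := hC0 j; positivity) (Finset.mem_range.mpr (by omega))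
      refine le_trans ?_ hs
      calc _ ≤ Real.log p ^ k * (C k * (p:ℝ) ^ (-σ * (2:ℕ))) := by
            have := hlog p; gcongr
        _ = _ := by
            rw [show -σ * ((2:ℕ):ℝ) = -(2 * σ) by push_cast; ring]; ring
    · have hv : vP N σ p kf = 0 := by unfold vP; rw [if_neg hp]; rfl
      have hgk : g k (c' p) p = 0 := by rw [hg]; dsimp only; rw [if_neg hp]
      rw [hv, hgk]; simpa using hW0 p
  have h3 := norm_add_le (∑ p ∈ Finset.Ico m1 m, g k (c' p) p - ∑ p ∈ Finset.Ico m1 m, c' p * vP N σ p kf)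
    (∑ p ∈ Finset.Ico m1 m, c' p * vP N σ p kf - (b k - ∑ p ∈ Finset.range m1, g k 1 p))
  rw [show ∑ p ∈ Finset.range m1, g k 1 p + ∑ p ∈ Finset.Ico m1 m, g k (c' p) p - b k
    = (∑ p ∈ Finset.Ico m1 m, g k (c' p) p - ∑ p ∈ Finset.Ico m1 m, c' p * vP N σ p kf) +
    (∑ p ∈ Finset.Ico m1 m, c' p * vP N σ p kf - (b k - ∑ p ∈ Finset.range m1, g k 1 p)) by ring]
  linarith


lemma cauchy_L1 (k : ℕ) {r : ℝ} (hr : 0 < r) {s : ℂ} {f : ℂ → ℂ} (hf : DifferentiableOn ℂ f (Metric.closedBall s r)) :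
    ‖iteratedDeriv k f s‖ ≤ (k.factorial : ℝ) / r ^ k * ∫ θ in (0:ℝ)..(2 * Real.pi), ‖f (circleMap s r θ)‖ := by
  have hd : DiffContOnCl ℂ f (Metric.ball s r) := by
    apply DifferentiableOn.diffContOnCl
    rwa [closure_ball _ hr.ne']
  have h1 := DiffContOnCl.circleIntegral_one_div_sub_center_pow_smul hr k hd
  have hcont : Continuous fun θ : ℝ => ‖f (circleMap s r θ)‖ :=
    (hf.continuousOn.comp_continuous (continuous_circleMap s r) (fun θ => circleMap_mem_closedBall s hr.le θ)).norm
  have h2 : ‖∮ (z : ℂ) in C(s, r), (1 / (z - s) ^ (k + 1)) • f z‖ ≤ ∫ θ in (0:ℝ)..(2 * Real.pi), 1 / r ^ k * ‖f (circleMap s r θ)‖ := by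
    unfold circleIntegral
    refine intervalIntegral.norm_integral_le_of_norm_le (by positivity) ?_ ((continuous_const.mul hcont).intervalIntegrable _ _)
    refine Eventually.of_forall fun θ _ => le_of_eq ?_
    rw [norm_smul, norm_smul, norm_div, norm_pow, circleMap_sub_center, norm_circleMap_zero, deriv_circleMap, norm_mul, norm_circleMap_zero,
      abs_of_pos hr, norm_I, norm_one]
    field_simp
    ring
  rw [h1, intervalIntegral.integral_const_mul, norm_smul] at h2
  have hfac : (0:ℝ) < k.factorial := by exact_mod_cast k.factorial_pos
  have h3 : ‖(2 * (Real.pi:ℂ) * I / (k.factorial : ℂ))‖ = 2 * Real.pi / k.factorial := by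
    simp [abs_of_pos Real.pi_pos]
  rw [h3] at h2
  have hpi : 1 ≤ 2 * Real.pi := by have := Real.pi_gt_three; linarith
  set X := ∫ θ in (0:ℝ)..(2 * Real.pi), ‖f (circleMap s r θ)‖
  set D := ‖iteratedDeriv k f s‖ with hD
  have hD0 : 0 ≤ D := norm_nonneg _
  have h4 : D / k.factorial ≤ 1 / r ^ k * X := by
    refine le_trans ?_ h2
    rw [div_eq_inv_mul, div_mul_eq_mul_div, div_eq_inv_mul]
    gcongr
    nlinarith
  rw [div_le_iff₀ hfac] at h4
  calc D ≤ _ := h4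
    _ = _ := by ring

lemma L1_le_L2 {g : ℝ → ℝ} (hg : Continuous g) {μ : ℝ} (hμ : 0 < μ)
    (h : ∫ θ in (0:ℝ)..(2 * Real.pi), g θ ^ 2 ≤ μ ^ 2) : ∫ θ in (0:ℝ)..(2 * Real.pi), g θ ≤ 5 * μ := by
  have hpi := Real.pi_lt_four
  have h1 : ∫ θ in (0:ℝ)..(2 * Real.pi), g θ ≤ ∫ θ in (0:ℝ)..(2 * Real.pi), (μ / 2 + 1 / (2 * μ) * g θ ^ 2) := by
    refine intervalIntegral.integral_mono_on (by have := Real.pi_pos; positivity) (hg.intervalIntegrable _ _) ?_ fun θ _ => ?_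
    · exact Continuous.intervalIntegrable (by fun_prop) _ _
    · have : μ / 2 + 1 / (2 * μ) * g θ ^ 2 - g θ = (g θ - μ) ^ 2 / (2 * μ) := by field_simp; ring
      have h0 : 0 ≤ (g θ - μ) ^ 2 / (2 * μ) := by positivity
      linarith
  rw [intervalIntegral.integral_add (by simp) (Continuous.intervalIntegrable (by fun_prop) _ _), intervalIntegral.integral_const_mul,
    intervalIntegral.integral_const] at h1
  have h2 : 1 / (2 * μ) * ∫ θ in (0:ℝ)..(2 * Real.pi), g θ ^ 2 ≤ 1 / (2 * μ) * μ ^ 2 := by gcongr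
  have h3 : 1 / (2 * μ) * μ ^ 2 = μ / 2 := by field_simp
  simp only [sub_zero, smul_eq_mul] at h1
  nlinarith

lemma cauchy_L2 (N : ℕ) {r : ℝ} (hr : 0 < r) {η : ℝ} (hη : 0 < η) : ∃ κ > 0, ∀ (s : ℂ) (f : ℂ → ℂ),
    DifferentiableOn ℂ f (Metric.closedBall s r) → ∫ θ in (0:ℝ)..(2 * Real.pi), ‖f (circleMap s r θ)‖ ^ 2 ≤ κ →
    ∀ k ≤ N, ‖iteratedDeriv k f s‖ < η := by
  set B := 1 + ∑ k ∈ Finset.range (N + 1), (k.factorial : ℝ) / r ^ k * 5 with hB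
  have hterm : ∀ k : ℕ, 0 ≤ (k.factorial : ℝ) / r ^ k * 5 := fun k => by positivity
  have hB0 : 0 < B := by
    have := Finset.sum_nonneg (s := Finset.range (N + 1)) fun k _ => hterm k
    linarith
  refine ⟨(η / B) ^ 2, by positivity, fun s f hf h k hk => ?_⟩
  have hcont : Continuous fun θ : ℝ => ‖f (circleMap s r θ)‖ :=
    (hf.continuousOn.comp_continuous (continuous_circleMap s r) (fun θ => circleMap_mem_closedBall s hr.le θ)).norm
  have h1 := L1_le_L2 hcont (show 0 < η / B by positivity) h
  have h2 := cauchy_L1 k hr hf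
  have hle : (k.factorial : ℝ) / r ^ k * 5 < B := by
    have := Finset.single_le_sum (f := fun k : ℕ => (k.factorial : ℝ) / r ^ k * 5) (fun k _ => hterm k)
      (Finset.mem_range.mpr (show k < N + 1 by omega))
    linarith
  calc _ ≤ _ := h2
    _ ≤ (k.factorial : ℝ) / r ^ k * (5 * (η / B)) := by gcongr
    _ = (k.factorial : ℝ) / r ^ k * 5 * (η / B) := by ring
    _ < B * (η / B) := by gcongr
    _ = η := by field_simp

lemma LS_cont (N : ℕ) {S : Finset ℕ} (hS : ∀ p ∈ S, p.Prime) {c : ℕ → ℂ} (hc : ∀ p, ‖c p‖ = 1) {z : ℂ} (hz : 0 < z.re)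
    {η : ℝ} (hη : 0 < η) : ∃ κ > 0, ∀ c' : ℕ → ℂ, (∀ p, ‖c' p‖ = 1) → (∀ p ∈ S, ‖c' p - c p‖ ≤ κ) →
      ∀ k ≤ N, ‖iteratedDeriv k (LS S c') z - iteratedDeriv k (LS S c) z‖ < η := by
  by_contra hcon
  push Not at hcon
  have hcon' : ∀ j : ℕ, ∃ c' : ℕ → ℂ, (∀ p, ‖c' p‖ = 1) ∧ (∀ p ∈ S, ‖c' p - c p‖ ≤ 1 / ((j : ℝ) + 1)) ∧
      ∃ k ≤ N, η ≤ ‖iteratedDeriv k (LS S c') z - iteratedDeriv k (LS S c) z‖ := fun j => hcon _ (by positivity)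
  choose c' h1 h2 h3 using hcon'
  have hev : ∀ᶠ j in atTop, ∀ k ∈ Finset.range (N + 1), ‖iteratedDeriv k (LS S (c' j)) z - iteratedDeriv k (LS S c) z‖ < η := by
    rw [Filter.eventually_all_finset]
    intro k _
    have ht : Tendsto (fun j => iteratedDeriv k (LS S (c' j)) z) atTop (𝓝 (iteratedDeriv k (LS S c) z)) := by
      simp only [LS_jet hS (h1 _) hz, LS_jet hS hc hz]
      refine tendsto_finsetSum _ fun p hp => ?_
      refine Tendsto.const_mul _ ?_
      have hG : ContinuousAt (Gk k) (c p * (p:ℂ) ^ (-z)) :=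
        ((Gk_diff k).differentiableAt (Metric.isOpen_ball.mem_nhds (by simpa using cpow_lt_one (hS p hp) (hc p) hz))).continuousAt
      refine hG.tendsto.comp (Tendsto.mul_const _ ?_)
      rw [tendsto_iff_norm_sub_tendsto_zero]
      exact squeeze_zero (fun _ => norm_nonneg _) (fun j => h2 j p hp) tendsto_one_div_add_atTop_nhds_zero_nat
    have := (Metric.tendsto_nhds.mp ht) η hη
    simpa only [dist_eq_norm] using this
  obtain ⟨j, hj⟩ := hev.exists
  obtain ⟨k, hk, hk2⟩ := h3 j
  exact absurd (hj k (Finset.mem_range.mpr (by omega))) (not_lt.mpr hk2)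

lemma ES_diff {S : Finset ℕ} (hS : ∀ p ∈ S, p.Prime) : Differentiable ℂ (ES S) := by
  unfold ES
  refine Differentiable.fun_finsetProd fun p hp => ?_
  have hp0 : (p:ℂ) ≠ 0 := by exact_mod_cast (hS p hp).ne_zero
  intro z
  exact (((hasDerivAt_id' z).neg).const_cpow (Or.inl hp0)).differentiableAt.const_sub 1

lemma ES_LS {S : Finset ℕ} (hS : ∀ p ∈ S, p.Prime) (t : ℝ) {z : ℂ} (hz : 0 < z.re) :
    cexp (LS S (fun p => en p t) z) * ES S (z + t * I) = 1 := by
  rw [← LS_exp hS (fun p => en_norm p t) hz]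
  congr 1
  unfold ES
  refine Finset.prod_congr rfl fun p hp => ?_
  rw [cpow_en (hS p hp).ne_zero, mul_comm]

lemma key0 (n : ℕ) (a : ℕ → ℂ) (ha : a 0 ≠ 0) {σ : ℝ} (hσ : 1 / 2 < σ) (hσ1 : σ < 1) {δ : ℝ} (hδ : 0 < δ) (T0 : ℝ) :
    ∃ t ≥ T0, ∀ k ≤ n, ‖iteratedDeriv k riemannZeta (σ + t * I) - a k‖ < δ := by
  obtain ⟨r, hr, hr1, hr2⟩ : ∃ r : ℝ, 0 < r ∧ 1 / 2 < σ - r ∧ σ + r < 1 := by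
    refine ⟨min (σ - 1 / 2) (1 - σ) / 2, ?_, ?_, ?_⟩
    · have := lt_min (sub_pos.mpr hσ) (sub_pos.mpr hσ1); linarith
    · have := min_le_left (σ - 1 / 2) (1 - σ); linarith
    · have := min_le_right (σ - 1 / 2) (1 - σ); linarith
  have hr3 : r ≤ 1 := by linarith
  obtain ⟨b, N, η, hη, hstab⟩ := jet_stab a ha n hδ
  obtain ⟨κ, hκ, hcau⟩ := cauchy_L2 N hr hη
  obtain ⟨y0, hy0⟩ := core hr hr3 hr1 hr2 hκ
  obtain ⟨S, hS, hSy, c, hc, htar⟩ := targets N hσ hσ1 b (half_pos hη) y0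
  have hσre : 0 < (σ:ℂ).re := by simp; linarith
  obtain ⟨κ', hκ', hLS⟩ := LS_cont N hS hc hσre (half_pos hη)
  obtain ⟨t, ht, hintg, hen⟩ := hy0 S hS hSy c hc κ' hκ' (max T0 1)
  refine ⟨t, le_trans (le_max_left _ _) ht, ?_⟩
  have ht1 : 1 ≤ t := le_trans (le_max_right _ _) ht
  have hne : ∀ z ∈ Metric.closedBall (σ:ℂ) r, z + t * I ≠ 1 := by
    intro z hz h
    have h1 : ‖z - σ‖ ≤ r := by simpa [dist_eq_norm] using hz
    have h2 := (Complex.abs_re_le_norm _).trans h1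
    have h3 := congrArg Complex.re h
    simp at h3 h2
    have := (abs_le.mp h2).2
    linarith
  have hFd : ∀ z : ℂ, z + t * I ≠ 1 → DifferentiableAt ℂ (fun z => ES S (z + t * I) * riemannZeta (z + t * I)) z := by
    intro z hz
    have h1 : DifferentiableAt ℂ (fun z : ℂ => z + t * I) z := by fun_prop
    exact (DifferentiableAt.comp (g := ES S) z (ES_diff hS _) h1).mul
      (DifferentiableAt.comp (g := riemannZeta) z (differentiableAt_riemannZeta hz) h1)
  have hopen : IsOpen {z : ℂ | z + t * I ≠ 1} := isOpen_ne_fun (by fun_prop) (by fun_prop)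
  have hσne : (σ:ℂ) + t * I ≠ 1 := hne _ (Metric.mem_closedBall_self hr.le)
  have hFan : AnalyticAt ℂ (fun z => ES S (z + t * I) * riemannZeta (z + t * I)) (σ:ℂ) := by
    rw [Complex.analyticAt_iff_eventually_differentiableAt]
    filter_upwards [hopen.mem_nhds hσne] with z hz using hFd z hz
  have hf : ∀ k ≤ N, ‖iteratedDeriv k (fun z => ES S (z + t * I) * riemannZeta (z + t * I) - 1) (σ:ℂ)‖ < η :=
    hcau _ _ (fun z hz => ((hFd z (hne z hz)).sub_const 1).differentiableWithinAt) hintg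
  have hLan := LS_analytic hS (fun p => en_norm p t) hσre
  intro k hk
  have e0 : iteratedDeriv k riemannZeta (σ + t * I) = iteratedDeriv k (fun z => riemannZeta (z + t * I)) (σ:ℂ) := by
    rw [iteratedDeriv_comp_add_const]
  have e1 : (fun z => riemannZeta (z + t * I)) =ᶠ[𝓝 (σ:ℂ)]
      fun z => cexp (LS S (fun p => en p t) z) * (ES S (z + t * I) * riemannZeta (z + t * I)) := by
    filter_upwards [halfplane_nhds hσre] with z hz
    rw [← mul_assoc, ES_LS hS t hz, one_mul]
  rw [e0, e1.iteratedDeriv_eq k, jet_mul hLan.cexp' hFan]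
  have e2 : (fun j => iteratedDeriv j (fun z => cexp (LS S (fun p => en p t) z)) (σ:ℂ)) =
      Ej (fun j => iteratedDeriv j (LS S (fun p => en p t)) (σ:ℂ)) := by
    funext j; exact jet_exp hLan j
  rw [e2]
  refine hstab _ _ ?_ ?_ k hk
  · intro j hj
    have h1 := hLS (fun p => en p t) (fun p => en_norm p t) hen j hj
    have h2 := htar j hj
    have h3 := norm_sub_le_norm_sub_add_norm_sub (iteratedDeriv j (LS S (fun p => en p t)) (σ:ℂ)) (iteratedDeriv j (LS S c) (σ:ℂ)) (b j)
    linarith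
  · intro j hj
    have h1 := hf j hj
    rw [iteratedDeriv_fun_sub hFan.contDiffAt contDiffAt_const, iteratedDeriv_const] at h1
    exact h1


lemma key1 (n : ℕ) (a : Fin (n + 1) → ℂ) {δ : ℝ} (hδ : 0 < δ) (T0 : ℝ) :
    ∃ t ≥ T0, ∃ σ : ℝ, 1 / 2 < σ ∧ σ < 1 / 2 + δ ∧
      ∀ i : Fin (n + 1), ‖iteratedDeriv (i : ℕ) riemannZeta (σ + t * I) - a i‖ < δ := by
  obtain ⟨σ, h1, h2, h3⟩ : ∃ σ : ℝ, 1 / 2 < σ ∧ σ < 1 / 2 + δ ∧ σ < 1 := by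
    refine ⟨1 / 2 + min δ (1 / 2) / 2, ?_, ?_, ?_⟩
    · have := lt_min hδ (show (0:ℝ) < 1 / 2 by norm_num); linarith
    · have := min_le_left δ (1 / 2); linarith
    · have := min_le_right δ (1 / 2); linarith
  set b : ℕ → ℂ := fun k => if h : k < n + 1 then (if a ⟨k, h⟩ = 0 then ((δ / 2 : ℝ) : ℂ) else a ⟨k, h⟩) else 0 with hb
  have hb1 : ∀ i : Fin (n + 1), b i = if a i = 0 then ((δ / 2 : ℝ) : ℂ) else a i := by
    intro i; rw [hb]; dsimp only; rw [dif_pos i.isLt]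
  have hb0 : b 0 ≠ 0 := by
    have := hb1 0
    rw [Fin.val_zero] at this
    rw [this]
    split_ifs with h
    · exact_mod_cast (half_pos hδ).ne'
    · exact h
  obtain ⟨t, ht, hk⟩ := key0 n b hb0 h1 h3 (half_pos hδ) T0
  refine ⟨t, ht, σ, h1, h2, fun i => ?_⟩
  have h4 := hk i (by omega)
  have h5 : ‖b i - a i‖ ≤ δ / 2 := by
    rw [hb1 i]
    split_ifs with h
    · rw [h, sub_zero, norm_real, Real.norm_of_nonneg (half_pos hδ).le]
    · simp; linarith
  have h6 := norm_sub_le_norm_sub_add_norm_sub (iteratedDeriv (i:ℕ) riemannZeta (σ + t * I)) (b i) (a i)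
  linarith

theorem stmt10 (n : ℕ) :
    ∃ ε : ℝ → ℝ, (∀ t : ℝ, 1 ≤ t → 0 < ε t) ∧ Tendsto ε atTop (𝓝 0) ∧
      Dense {v : Fin (n + 1) → ℂ | ∃ t : ℝ, 1 ≤ t ∧
        v = fun i : Fin (n + 1) =>
          iteratedDeriv (i : ℕ) riemannZeta ((1 / 2 : ℂ) + (ε t : ℝ) + t * Complex.I)} := by
  classical
  have hkey : ∀ (m : ℕ) (T0 : ℝ), ∃ t ≥ T0, ∃ σ : ℝ, 1 / 2 < σ ∧ σ < 1 / 2 + 1 / ((m : ℝ) + 1) ∧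
      ∀ i : Fin (n + 1), ‖iteratedDeriv (i : ℕ) riemannZeta (σ + t * I)
        - TopologicalSpace.denseSeq (Fin (n + 1) → ℂ) (Nat.unpair m).1 i‖ < 1 / ((m : ℝ) + 1) :=
    fun m T0 => key1 n _ (by positivity) T0
  choose tf htf σf hσ1 hσ2 hap using hkey
  obtain ⟨base, hbase0, hbaseS⟩ : ∃ base : ℕ → ℝ, base 0 = 1 ∧ ∀ m, base (m + 1) = tf m (base m) + 1 :=
    ⟨fun m => Nat.rec 1 (fun m x => tf m x + 1) m, rfl, fun _ => rfl⟩
  obtain ⟨T, hT⟩ : ∃ T : ℕ → ℝ, ∀ m, T m = tf m (base m) := ⟨_, fun _ => rfl⟩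
  obtain ⟨s, hs⟩ : ∃ s : ℕ → ℝ, ∀ m, s m = σf m (base m) := ⟨_, fun _ => rfl⟩
  have hTmono : StrictMono T := by
    refine strictMono_nat_of_lt_succ fun m => ?_
    have := htf (m + 1) (base (m + 1))
    rw [hT (m + 1)]
    rw [hT m]
    have h2 := hbaseS m
    linarith
  have hT1 : ∀ m, 1 ≤ T m := by
    intro m
    have h0 : 1 ≤ T 0 := by rw [hT, ← hbase0]; exact htf 0 _
    exact h0.trans (hTmono.monotone (Nat.zero_le m))
  set ε : ℝ → ℝ := fun t => if h : ∃ m, T m = t then s h.choose - 1 / 2 else 1 / (|t| + 1) with hε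
  have hεT : ∀ m, ε (T m) = s m - 1 / 2 := by
    intro m
    have hex : ∃ m', T m' = T m := ⟨m, rfl⟩
    rw [hε]; dsimp only
    rw [dif_pos hex, hTmono.injective hex.choose_spec]
  have hεn : ∀ t, (¬ ∃ m, T m = t) → ε t = 1 / (|t| + 1) := by
    intro t h
    rw [hε]; dsimp only
    rw [dif_neg h]
  have hpos : ∀ t, 0 < ε t := by
    intro t
    by_cases h : ∃ m, T m = t
    · obtain ⟨m, rfl⟩ := h
      rw [hεT, hs]
      linarith [hσ1 m (base m)]
    · rw [hεn t h]; positivity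
  clear_value ε
  refine ⟨ε, fun t _ => hpos t, ?_, ?_⟩
  · rw [Metric.tendsto_atTop]
    intro e he
    obtain ⟨M, hM⟩ := exists_nat_one_div_lt he
    refine ⟨max (T M) (1 / e), fun t ht => ?_⟩
    rw [Real.dist_eq, sub_zero, abs_of_pos (hpos t)]
    by_cases h : ∃ m, T m = t
    · obtain ⟨m, rfl⟩ := h
      have hm : M ≤ m := hTmono.le_iff_le.mp ((le_max_left _ _).trans ht)
      rw [hεT, hs]
      have h1 := hσ2 m (base m)
      have h2 : 1 / ((m:ℝ) + 1) ≤ 1 / ((M:ℝ) + 1) := by gcongr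
      linarith
    · rw [hεn t h]
      have h1 : 1 / e ≤ t := (le_max_right _ _).trans ht
      have h2 := le_abs_self t
      rw [div_lt_iff₀ (by positivity)]
      rw [div_le_iff₀ he] at h1
      nlinarith
  · rw [Metric.dense_iff]
    intro x r hr
    obtain ⟨y, hy, i, rfl⟩ := (Metric.dense_iff.mp (TopologicalSpace.denseRange_denseSeq (Fin (n + 1) → ℂ))) x (r / 2) (half_pos hr)
    obtain ⟨j, hj⟩ := exists_nat_one_div_lt (half_pos hr)
    set m := Nat.pair i j with hm
    refine ⟨_, ?_, T m, hT1 m, rfl⟩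
    have h1 : (j:ℝ) ≤ m := by exact_mod_cast Nat.right_le_pair i j
    have h2 : 1 / ((m:ℝ) + 1) ≤ 1 / ((j:ℝ) + 1) := by gcongr
    rw [Metric.mem_ball] at hy ⊢
    refine lt_of_le_of_lt (dist_triangle _ (TopologicalSpace.denseSeq (Fin (n + 1) → ℂ) i) _) ?_
    have h3 : dist (fun k : Fin (n + 1) => iteratedDeriv (k : ℕ) riemannZeta ((1 / 2 : ℂ) + (ε (T m) : ℝ) + T m * Complex.I))
        (TopologicalSpace.denseSeq (Fin (n + 1) → ℂ) i) ≤ 1 / ((m:ℝ) + 1) := by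
      rw [dist_pi_le_iff (by positivity)]
      intro k
      have h4 := hap m (base m) k
      rw [← hT, ← hs, hm, Nat.unpair_pair] at h4
      rw [dist_eq_norm, hεT m]
      have e : (1 / 2 : ℂ) + ((s m - 1 / 2 : ℝ) : ℂ) + T m * I = (s m : ℂ) + T m * I := by push_cast; ring
      rw [e]
      exact h4.le
    linarith
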